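/- arXiv:2303.03803 — 9 statements merged into one kernel-verified Lean document; each statement's English description precedes it below -/
import Mathlib

section
/- For every real ε > 0 there exists N such that for every integer n ≥ N there exists a finite hypergraph H = (V, E) in which every edge has cardinality at least n, at least one edge has cardinality exactly n, H admits no proper 2-colouring, and q(H) = ∑_{e ∈ E} 2^{-|e|} ≤ (1 + ε) · (e · ln 2 / 8) · n². (Here e denotes Euler's number and ln the natural logarithm.) In other words, q(n) ≤ (1 + o(1)) · (e ln 2 / 8) · n². -/
open Finset in
/-- If every `x ∈ U` is related to at least a proportion `p` of the elements of `Y`, then some `m`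
elements of `Y` leave at most a proportion `(1 - p) ^ m` of `U` unrelated to all of them. -/
lemma exists_partial_cover {X Y : Type*} (R : X → Y → Prop) (T : Finset Y)
    (hT : T.Nonempty) (p : ℝ) (hp : p ≤ 1) (U : Finset X)
    (h : ∀ x ∈ U, ∃ D ⊆ T, (∀ y ∈ D, R x y) ∧ p * (T.card : ℝ) ≤ D.card) (m : ℕ) :
    ∃ S ⊆ T, ∃ W ⊆ U, S.card ≤ m ∧ (W.card : ℝ) ≤ (1 - p) ^ m * U.card ∧
      ∀ x ∈ U, x ∉ W → ∃ y ∈ S, R x y := by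
  classical
  induction m with
  | zero => exact ⟨∅, by simp, U, subset_rfl, by simp, by simp, fun x hx hx' => absurd hx hx'⟩
  | succ m ih =>
    obtain ⟨S, hST, W, hWU, hSm, hW, hcov⟩ := ih
    obtain ⟨y, hy, hyW⟩ : ∃ y ∈ T, p * W.card ≤ ((W.filter (R · y)).card : ℝ) := by
      by_contra! hlt
      have hsum : ∑ y ∈ T, ((W.filter (R · y)).card : ℝ) < ∑ _y ∈ T, p * (W.card : ℝ) :=
        sum_lt_sum_of_nonempty hT hlt
      have hcount : ∑ y ∈ T, (W.filter (R · y)).card = ∑ x ∈ W, (T.filter (R x)).card := by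
        simpa [bipartiteAbove, bipartiteBelow] using
          (sum_card_bipartiteAbove_eq_sum_card_bipartiteBelow (s := W) (t := T) R).symm
      have hlow : ∑ _x ∈ W, p * (T.card : ℝ) ≤ ∑ x ∈ W, ((T.filter (R x)).card : ℝ) := by
        refine sum_le_sum fun x hx => ?_
        obtain ⟨D, hDT, hDR, hD⟩ := h x (hWU hx)
        refine hD.trans ?_
        exact_mod_cast card_le_card fun y hy => mem_filter.2 ⟨hDT hy, hDR y hy⟩
      have hcount' : ∑ y ∈ T, ((W.filter (R · y)).card : ℝ) =
          ∑ x ∈ W, ((T.filter (R x)).card : ℝ) := by exact_mod_cast hcount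
      simp only [sum_const, nsmul_eq_mul] at hsum hlow
      nlinarith
    refine ⟨insert y S, insert_subset hy hST, W.filter (¬ R · y),
      (filter_subset _ _).trans hWU, (card_insert_le _ _).trans (by omega), ?_, ?_⟩
    · have hsplit : ((W.filter (R · y)).card : ℝ) + (W.filter (¬ R · y)).card = W.card := by
        exact_mod_cast card_filter_add_card_filter_not (s := W) (R · y)
      have := mul_le_mul_of_nonneg_left hW (sub_nonneg.2 hp)
      rw [pow_succ]
      nlinarith
    · intro x hx hxW
      by_cases hxW' : x ∈ W
      · refine ⟨y, mem_insert_self _ _, ?_⟩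
        by_contra hR
        exact hxW (mem_filter.2 ⟨hxW', hR⟩)
      · obtain ⟨z, hz, hR⟩ := hcov x hx hxW'
        exact ⟨z, mem_insert_of_mem hz, hR⟩

lemma two_mul_choose_le_choose_add_choose_sub (u j k : ℕ) (hj : j ≤ u) :
    2 * u.choose k ≤ (u + j).choose k + (u - j).choose k := by
  induction j with
  | zero => simp [two_mul]
  | succ j ih =>
    refine (ih (by omega)).trans ?_
    obtain _ | k := k
    · simp
    obtain ⟨d, rfl⟩ : ∃ d, u = d + j + 1 := ⟨u - j - 1, by omega⟩
    have h1 : d + j + 1 - j = d + 1 := by omega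
    have h2 : d + j + 1 - (j + 1) = d := by omega
    rw [h1, h2, ← add_assoc (d + j + 1) j 1, Nat.choose_succ_succ, Nat.choose_succ_succ]
    have : d.choose k ≤ (d + j + 1 + j).choose k := Nat.choose_le_choose k (by omega)
    simp only [Nat.succ_eq_add_one]
    omega

lemma two_mul_choose_le_of_add_eq {u a b : ℕ} (k : ℕ) (hab : a + b = 2 * u) :
    2 * u.choose k ≤ a.choose k + b.choose k := by
  rcases le_total u a with h | h
  · have := two_mul_choose_le_choose_add_choose_sub u (a - u) k (by omega)
    rwa [show u + (a - u) = a by omega, show u - (a - u) = b by omega] at this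
  · have := two_mul_choose_le_choose_add_choose_sub u (b - u) k (by omega)
    rw [show u + (b - u) = b by omega, show u - (b - u) = a by omega] at this
    omega

lemma choose_two_mul_le_exp {u n : ℕ} (hnu : n < u) (k : ℕ) (hk : k ≤ n) :
    ((2 * u).choose k : ℝ) ≤
      2 ^ k * u.choose k * Real.exp ((k : ℝ) ^ 2 / (4 * ((u : ℝ) - n))) := by
  induction k with
  | zero => simp
  | succ k ih =>
    have ih := ih (by omega)
    have hn : (0 : ℝ) < (u : ℝ) - n := sub_pos.2 (by exact_mod_cast hnu)
    have hkn : (k : ℝ) ≤ n := by exact_mod_cast (by omega : k ≤ n)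
    have e1 : ((2 * u).choose (k + 1) : ℝ) * (k + 1) = (2 * u).choose k * (2 * u - k) := by
      have h := Nat.choose_succ_right_eq (2 * u) k
      have hc : ((2 * u - k : ℕ) : ℝ) = 2 * u - k := by
        rw [Nat.cast_sub (by omega)]; push_cast; ring
      rw [← hc]; exact_mod_cast h
    have e2 : (u.choose (k + 1) : ℝ) * (k + 1) = u.choose k * (u - k) := by
      have h := Nat.choose_succ_right_eq u k
      rw [← Nat.cast_sub (by omega : k ≤ u)]; exact_mod_cast h
    have hstep : (2 * u - k : ℝ) ≤
        2 * (u - k) * Real.exp ((2 * k + 1) / (4 * ((u : ℝ) - n))) := by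
      have h1 := Real.add_one_le_exp ((2 * k + 1) / (4 * ((u : ℝ) - n)))
      have h2 : (2 * k + 1 : ℝ) / (4 * ((u : ℝ) - n)) * (4 * ((u : ℝ) - n)) = 2 * k + 1 :=
        div_mul_cancel₀ _ (by positivity)
      have h3 : (0 : ℝ) ≤ (2 * k + 1) / (4 * ((u : ℝ) - n)) := by positivity
      nlinarith [mul_nonneg h3 (sub_nonneg.2 hkn),
        mul_le_mul_of_nonneg_left h1 (by linarith : (0 : ℝ) ≤ 2 * (u - k))]
    have hexp : Real.exp (((k + 1 : ℕ) : ℝ) ^ 2 / (4 * ((u : ℝ) - n))) =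
        Real.exp ((k : ℝ) ^ 2 / (4 * ((u : ℝ) - n))) *
          Real.exp ((2 * k + 1) / (4 * ((u : ℝ) - n))) := by
      rw [← Real.exp_add]; congr 1; push_cast; ring
    rw [hexp]
    refine le_of_mul_le_mul_right ?_ (by positivity : (0 : ℝ) < k + 1)
    have hk0 : (0 : ℝ) ≤ 2 * u - k := by linarith
    calc ((2 * u).choose (k + 1) : ℝ) * (k + 1) = (2 * u).choose k * (2 * u - k) := e1
      _ ≤ (2 ^ k * u.choose k * Real.exp ((k : ℝ) ^ 2 / (4 * ((u : ℝ) - n)))) *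
          (2 * (u - k) * Real.exp ((2 * k + 1) / (4 * ((u : ℝ) - n)))) := by gcongr
      _ = 2 ^ (k + 1) * (u.choose k * (u - k)) *
          (Real.exp ((k : ℝ) ^ 2 / (4 * ((u : ℝ) - n))) *
          Real.exp ((2 * k + 1) / (4 * ((u : ℝ) - n)))) := by ring
      _ = _ := by rw [← e2]; ring

lemma exists_large_monochromatic {V : Type*} [Fintype V] {u : ℕ}
    (hV : Fintype.card V = 2 * u) (c : V → Bool) :
    ∃ e : Finset V, u ≤ e.card ∧ ∀ v ∈ e, ∀ w ∈ e, c v = c w := by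
  classical
  have h := Finset.card_filter_add_card_filter_not (s := (Finset.univ : Finset V)) (c · = true)
  rw [Finset.card_univ, hV] at h
  rcases le_total u (Finset.univ.filter (c · = true)).card with h' | h'
  · refine ⟨_, h', fun v hv w hw => ?_⟩
    simp_all
  · refine ⟨Finset.univ.filter (¬ c · = true), by omega, fun v hv w hw => ?_⟩
    simp_all

open Finset in
lemma exists_many_monochromatic {V : Type*} [Fintype V] {u n : ℕ} (hn : 0 < n)
    (hV : Fintype.card V = 2 * u) (c : V → Bool) :
    ∃ D ⊆ powersetCard n (univ : Finset V),
      (∀ e ∈ D, ∀ v ∈ e, ∀ w ∈ e, c v = c w) ∧ 2 * u.choose n ≤ D.card := by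
  classical
  have h := card_filter_add_card_filter_not (s := (univ : Finset V)) (c · = true)
  rw [card_univ, hV] at h
  refine ⟨powersetCard n (univ.filter (c · = true)) ∪ powersetCard n (univ.filter (¬ c · = true)),
    union_subset (powersetCard_mono (subset_univ _)) (powersetCard_mono (subset_univ _)), ?_, ?_⟩
  · intro e he v hv w hw
    rcases mem_union.1 he with he | he
    · have hv' := (mem_powersetCard.1 he).1 hv
      have hw' := (mem_powersetCard.1 he).1 hw
      simp_all
    · have hv' := (mem_powersetCard.1 he).1 hv
      have hw' := (mem_powersetCard.1 he).1 hw
      simp_all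
  · rw [card_union_of_disjoint, card_powersetCard, card_powersetCard]
    · exact two_mul_choose_le_of_add_eq n h
    · rw [disjoint_left]
      intro e he he'
      obtain ⟨hs, hc⟩ := mem_powersetCard.1 he
      obtain ⟨v, hv⟩ := card_pos.1 (hc ▸ hn)
      exact (mem_filter.1 ((mem_powersetCard.1 he').1 hv)).2 (mem_filter.1 (hs hv)).2

open Finset in
/-- On `2 * u` vertices there is a non-2-colourable hypergraph made of about `u * log 2 / p` edges
of size `n`, where `p` is the least possible proportion of monochromatic `n`-sets, together with
one edge of size at least `u` for each of at most `2 ^ u` remaining colourings. -/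
lemma exists_nonTwoColourable {u n : ℕ} (hn : 2 ≤ n) (hnu : n < u) :
    ∃ E : Finset (Finset (Fin (2 * u))),
      (∀ e ∈ E, n ≤ e.card) ∧ (∃ e ∈ E, e.card = n) ∧
      (∀ c : Fin (2 * u) → Bool, ∃ e ∈ E, ∀ v ∈ e, ∀ w ∈ e, c v = c w) ∧
      ∑ e ∈ E, ((2 : ℝ) ^ e.card)⁻¹ ≤
        u * (Real.log 2 / 2) * Real.exp ((n : ℝ) ^ 2 / (4 * ((u : ℝ) - n))) + 3 := by
  classical
  set T := powersetCard n (univ : Finset (Fin (2 * u))) with hTdef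
  have hTcard : T.card = (2 * u).choose n := by simp [hTdef]
  have hTpos : 0 < T.card := hTcard ▸ Nat.choose_pos (by omega)
  have hT : T.Nonempty := card_pos.1 hTpos
  have hTpos' : (0 : ℝ) < T.card := by exact_mod_cast hTpos
  have hupos : (0 : ℝ) < u.choose n := by exact_mod_cast Nat.choose_pos hnu.le
  set p : ℝ := 2 * u.choose n / T.card with hp
  have hp0 : 0 < p := by positivity
  have hmul : p * T.card = 2 * u.choose n := div_mul_cancel₀ _ hTpos'.ne'
  have hmany : ∀ c ∈ (univ : Finset (Fin (2 * u) → Bool)), ∃ D ⊆ T,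
      (∀ e ∈ D, ∀ v ∈ e, ∀ w ∈ e, c v = c w) ∧ p * (T.card : ℝ) ≤ D.card := by
    intro c _
    obtain ⟨D, hDT, hD, hcard⟩ :=
      exists_many_monochromatic (V := Fin (2 * u)) (u := u) (n := n) (by omega) (by simp) c
    exact ⟨D, hDT, hD, by rw [hmul]; exact_mod_cast hcard⟩
  have hp1 : p ≤ 1 := by
    obtain ⟨D, hDT, -, hD⟩ := hmany (fun _ => true) (mem_univ _)
    have : (D.card : ℝ) ≤ T.card := by exact_mod_cast card_le_card hDT
    nlinarith
  set m := ⌈u * Real.log 2 / p⌉₊ with hm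
  obtain ⟨S, hST, W, -, hSm, hW, hcov⟩ := exists_partial_cover
    (fun (c : Fin (2 * u) → Bool) (e : Finset (Fin (2 * u))) => ∀ v ∈ e, ∀ w ∈ e, c v = c w)
    T hT p hp1 univ hmany m
  have hWcard : (W.card : ℝ) ≤ 2 ^ u := by
    have h1 : u * Real.log 2 ≤ p * m := by
      have := Nat.le_ceil (u * Real.log 2 / p)
      rw [div_le_iff₀ hp0] at this
      linarith
    have h2 : (1 - p) ^ m ≤ ((2 : ℝ) ^ u)⁻¹ := by
      calc (1 - p) ^ m ≤ Real.exp (-p) ^ m :=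
            pow_le_pow_left₀ (sub_nonneg.2 hp1) (Real.one_sub_le_exp_neg p) m
        _ = Real.exp (-(p * m)) := by rw [← Real.exp_nat_mul]; ring_nf
        _ ≤ Real.exp (-(u * Real.log 2)) := Real.exp_le_exp.2 (neg_le_neg h1)
        _ = ((2 : ℝ) ^ u)⁻¹ := by
            rw [Real.exp_neg, Real.exp_nat_mul, Real.exp_log (by norm_num)]
    refine hW.trans ((mul_le_mul_of_nonneg_right h2 (by positivity)).trans_eq ?_)
    simp only [card_univ, Fintype.card_pi, Fintype.card_bool, prod_const, Fintype.card_fin]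
    push_cast
    rw [two_mul, pow_add, inv_mul_cancel_left₀ (by positivity)]
  choose g hgu hg using exists_large_monochromatic (V := Fin (2 * u)) (u := u) (by simp)
  obtain ⟨e₀, he₀⟩ := hT
  have hcardT : ∀ e ∈ T, e.card = n := fun e he => (mem_powersetCard.1 he).2
  refine ⟨insert e₀ S ∪ W.image g, ?_, ⟨e₀, by simp, hcardT e₀ he₀⟩, ?_, ?_⟩
  · intro e he
    rcases mem_union.1 he with he | he
    · exact (hcardT e (insert_subset he₀ hST he)).ge
    · obtain ⟨c, -, rfl⟩ := mem_image.1 he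
      exact hnu.le.trans (hgu c)
  · intro c
    by_cases hc : c ∈ W
    · exact ⟨g c, mem_union_right _ (mem_image_of_mem g hc), hg c⟩
    · obtain ⟨e, he, hec⟩ := hcov c (mem_univ _) hc
      exact ⟨e, mem_union_left _ (mem_insert_of_mem he), hec⟩
  · have hsmall : ∑ e ∈ insert e₀ S, ((2 : ℝ) ^ e.card)⁻¹ ≤ (m + 1) * ((2 : ℝ) ^ n)⁻¹ := by
      rw [sum_congr rfl fun e he => by rw [hcardT e (insert_subset he₀ hST he)]]
      rw [sum_const, nsmul_eq_mul]
      gcongr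
      exact_mod_cast (card_insert_le e₀ S).trans (by omega)
    have hlarge : ∑ e ∈ W.image g, ((2 : ℝ) ^ e.card)⁻¹ ≤ 1 := by
      calc ∑ e ∈ W.image g, ((2 : ℝ) ^ e.card)⁻¹ ≤ ∑ _e ∈ W.image g, ((2 : ℝ) ^ u)⁻¹ := by
            refine sum_le_sum fun e he => ?_
            obtain ⟨c, -, rfl⟩ := mem_image.1 he
            gcongr
            · norm_num
            · exact hgu c
        _ = (W.image g).card * ((2 : ℝ) ^ u)⁻¹ := by rw [sum_const, nsmul_eq_mul]
        _ ≤ 2 ^ u * ((2 : ℝ) ^ u)⁻¹ := by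
            gcongr
            exact le_trans (by exact_mod_cast card_image_le) hWcard
        _ = 1 := mul_inv_cancel₀ (by positivity)
    have hunion : ∑ e ∈ insert e₀ S ∪ W.image g, ((2 : ℝ) ^ e.card)⁻¹ ≤
        ∑ e ∈ insert e₀ S, ((2 : ℝ) ^ e.card)⁻¹ + ∑ e ∈ W.image g, ((2 : ℝ) ^ e.card)⁻¹ := by
      rw [← sum_union_inter]
      exact le_add_of_nonneg_right (sum_nonneg fun _ _ => by positivity)
    have hlog : 0 ≤ Real.log 2 := Real.log_nonneg (by norm_num)
    have hmle : (m : ℝ) ≤ u * Real.log 2 / p + 1 := (Nat.ceil_lt_add_one (by positivity)).le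
    have hpinv : p⁻¹ * ((2 : ℝ) ^ n)⁻¹ ≤
        Real.exp ((n : ℝ) ^ 2 / (4 * ((u : ℝ) - n))) / 2 := by
      have := choose_two_mul_le_exp hnu n le_rfl
      rw [← hTcard] at this
      rw [hp, inv_div, ← div_eq_mul_inv, div_div, div_le_div_iff₀ (by positivity) (by norm_num)]
      linarith
    have hpow : ((2 : ℝ) ^ n)⁻¹ ≤ 1 := inv_le_one_of_one_le₀ (one_le_pow₀ (by norm_num))
    have hfinal : (m + 1) * ((2 : ℝ) ^ n)⁻¹ ≤
        u * (Real.log 2 / 2) * Real.exp ((n : ℝ) ^ 2 / (4 * ((u : ℝ) - n))) + 2 := by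
      calc (m + 1) * ((2 : ℝ) ^ n)⁻¹ ≤ (u * Real.log 2 / p + 2) * ((2 : ℝ) ^ n)⁻¹ := by
            exact mul_le_mul_of_nonneg_right (by linarith) (by positivity)
        _ = u * Real.log 2 * (p⁻¹ * ((2 : ℝ) ^ n)⁻¹) + 2 * ((2 : ℝ) ^ n)⁻¹ := by ring
        _ ≤ u * Real.log 2 * (Real.exp ((n : ℝ) ^ 2 / (4 * ((u : ℝ) - n))) / 2) + 2 * 1 := by
            gcongr
        _ = _ := by ring
    linarith

open Filter Topology in
lemma eventually_bound_le (ε : ℝ) (hε : 0 < ε) :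
    ∀ᶠ n : ℕ in atTop, ((n : ℝ) ^ 2 / 4 + 1) * (Real.log 2 / 2) *
        Real.exp ((n : ℝ) ^ 2 / ((n : ℝ) ^ 2 - 4 * n)) + 3 ≤
      (1 + ε) * (Real.exp 1 * Real.log 2 / 8) * (n : ℝ) ^ 2 := by
  have hinv : Tendsto (fun n : ℕ => ((n : ℝ))⁻¹) atTop (𝓝 0) := tendsto_inv_atTop_nhds_zero_nat
  have hlim : Tendsto (fun n : ℕ => (1 / 4 + ((n : ℝ))⁻¹ ^ 2) * (Real.log 2 / 2) *
      Real.exp (1 / (1 - 4 * ((n : ℝ))⁻¹)) + 3 * ((n : ℝ))⁻¹ ^ 2) atTop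
      (𝓝 ((1 / 4 + 0 ^ 2) * (Real.log 2 / 2) * Real.exp (1 / (1 - 4 * 0)) + 3 * 0 ^ 2)) := by
    have hexp : Tendsto (fun n : ℕ => Real.exp (1 / (1 - 4 * ((n : ℝ))⁻¹))) atTop
        (𝓝 (Real.exp (1 / (1 - 4 * 0)))) :=
      (Real.continuous_exp.tendsto _).comp
        (tendsto_const_nhds.div (tendsto_const_nhds.sub (hinv.const_mul 4)) (by norm_num))
    exact (((tendsto_const_nhds.add (hinv.pow 2)).mul_const _).mul hexp).add
      ((hinv.pow 2).const_mul 3)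
  have hpos : 0 < Real.exp 1 * Real.log 2 / 8 := by
    have := Real.log_pos (by norm_num : (1 : ℝ) < 2)
    positivity
  have hlt : (1 / 4 + 0 ^ 2) * (Real.log 2 / 2) * Real.exp (1 / (1 - 4 * 0)) + 3 * 0 ^ 2 <
      (1 + ε) * (Real.exp 1 * Real.log 2 / 8) := by
    norm_num
    nlinarith
  filter_upwards [hlim.eventually_lt_const hlt, eventually_gt_atTop 4] with n hn hn4
  have hn4' : (4 : ℝ) < n := by exact_mod_cast hn4
  have hn0 : (0 : ℝ) < n := by linarith
  have harg : 1 / (1 - 4 * ((n : ℝ))⁻¹) = (n : ℝ) ^ 2 / ((n : ℝ) ^ 2 - 4 * n) := by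
    have h1 : (n : ℝ) - 4 ≠ 0 := by linarith
    have h2 : (n : ℝ) ^ 2 - 4 * n = n * (n - 4) := by ring
    have h3 : 1 - 4 * ((n : ℝ))⁻¹ = (n - 4) / n := by field_simp
    rw [h2, h3]
    field_simp
  rw [harg] at hn
  refine le_trans (le_of_eq ?_) (mul_le_mul_of_nonneg_right hn.le (sq_nonneg (n : ℝ)))
  field_simp


/-- `q(n) ≤ (1+o(1)) · (e ln 2 / 8) · n²`: for every `ε > 0` there is `N` such that for every
`n ≥ N` there is a finite hypergraph `(V, E)` whose edges all have size at least `n` (and at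
least 2), with some edge of size exactly `n`, admitting no proper 2-colouring, and with
`∑_{e ∈ E} 2^{-|e|} ≤ (1+ε) · (e · ln 2 / 8) · n²`. -/
theorem q_upper_bound :
    ∀ ε : ℝ, 0 < ε → ∃ N : ℕ, ∀ n : ℕ, N ≤ n →
      ∃ (V : Type) (_ : Fintype V) (E : Finset (Finset V)),
        (∀ e ∈ E, 2 ≤ e.card) ∧
        (∀ e ∈ E, n ≤ e.card) ∧
        (∃ e ∈ E, e.card = n) ∧
        (∀ c : V → Bool, ∃ e ∈ E, ∀ v ∈ e, ∀ w ∈ e, c v = c w) ∧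
        ∑ e ∈ E, ((2 : ℝ) ^ e.card)⁻¹ ≤
          (1 + ε) * (Real.exp 1 * Real.log 2 / 8) * (n : ℝ) ^ 2 := by
  intro ε hε
  obtain ⟨N, hN⟩ := Filter.eventually_atTop.1 (eventually_bound_le ε hε)
  refine ⟨max N 5, fun n hn => ?_⟩
  have hn5 : 5 ≤ n := (le_max_right _ _).trans hn
  have hn5' : (5 : ℝ) ≤ n := by exact_mod_cast hn5
  set u := ⌈(n : ℝ) ^ 2 / 4⌉₊ with hu
  have hule : (u : ℝ) ≤ (n : ℝ) ^ 2 / 4 + 1 := (Nat.ceil_lt_add_one (by positivity)).le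
  have hleu : (n : ℝ) ^ 2 / 4 ≤ u := Nat.le_ceil _
  have hnu : n < u := by
    have : (n : ℝ) < u := by nlinarith
    exact_mod_cast this
  obtain ⟨E, hE, hEn, hcol, hsum⟩ := exists_nonTwoColourable (by omega : 2 ≤ n) hnu
  refine ⟨Fin (2 * u), inferInstance, E, fun e he => (by omega : 2 ≤ n).trans (hE e he),
    hE, hEn, hcol, hsum.trans (le_trans ?_ (hN n ((le_max_left _ _).trans hn)))⟩
  have hlog : 0 ≤ Real.log 2 := Real.log_nonneg (by norm_num)
  have hden : 0 < (n : ℝ) ^ 2 - 4 * n := by nlinarith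
  gcongr
  linarith
end

section
/- For every real ε > 0 there exists N such that for every even integer n ≥ N there exists an n-uniform hypergraph H₁ on a vertex set of cardinality n²/2, with at most (1 + ε) · (e · ln 2 / 8) · n² · 2^n edges, such that the number of proper 2-colourings of H₁ is at most 2^{n²/4}. -/
open Finset in
/-- Greedy covering: if every `a` is related to at least a fraction `p` of `P`, then there are
`k` elements of `P` such that at most a fraction `exp (-p * k)` of `S` is related to none. -/
theorem exists_greedy_cover {α β : Type*} [DecidableEq β] (r : α → β → Prop)
    [∀ a b, Decidable (r a b)] (S : Finset α) (P : Finset β) (hP : P.Nonempty) (p : ℝ)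
    (hp : ∀ a ∈ S, p * #P ≤ #{b ∈ P | r a b}) (k : ℕ) :
    ∃ E ⊆ P, #E ≤ k ∧ (#{a ∈ S | ∀ b ∈ E, ¬ r a b} : ℝ) ≤ #S * Real.exp (-p * k) := by
  induction k with
  | zero => exact ⟨∅, by simp, by simp, by simp⟩
  | succ k ih =>
    obtain ⟨E, hEP, hEk, hE⟩ := ih
    set T := {a ∈ S | ∀ b ∈ E, ¬ r a b} with hT
    obtain ⟨b, hb, hbT⟩ : ∃ b ∈ P, p * #T ≤ #{a ∈ T | r a b} := by
      refine exists_le_of_sum_le hP ?_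
      have h1 : ∑ b ∈ P, (#{a ∈ T | r a b} : ℝ) = ∑ a ∈ T, (#{b ∈ P | r a b} : ℝ) := by
        exact_mod_cast (sum_card_bipartiteAbove_eq_sum_card_bipartiteBelow r).symm
      have h2 : ∑ _a ∈ T, p * (#P : ℝ) ≤ ∑ a ∈ T, (#{b ∈ P | r a b} : ℝ) :=
        sum_le_sum fun a ha => hp a (mem_filter.1 ha).1
      rw [h1]
      refine le_trans (le_of_eq ?_) h2
      simp only [sum_const, nsmul_eq_mul]
      ring
    refine ⟨insert b E, insert_subset hb hEP, (card_insert_le _ _).trans (by omega), ?_⟩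
    have h3 : {a ∈ S | ∀ x ∈ insert b E, ¬ r a x} = {a ∈ T | ¬ r a b} := by
      ext a
      simp only [hT, mem_filter, forall_mem_insert]
      tauto
    have h4 : (#{a ∈ T | r a b} : ℝ) + #{a ∈ T | ¬ r a b} = #T := by
      exact_mod_cast card_filter_add_card_filter_not (s := T) (fun a => r a b)
    rw [h3]
    calc (#{a ∈ T | ¬ r a b} : ℝ) ≤ #T * (-p + 1) := by linarith
      _ ≤ #T * Real.exp (-p) := by gcongr; exact Real.add_one_le_exp _
      _ ≤ (#S * Real.exp (-p * k)) * Real.exp (-p) := by gcongr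
      _ = #S * Real.exp (-p * (k + 1 : ℕ)) := by
        rw [mul_assoc, ← Real.exp_add]
        push_cast
        ring_nf

theorem two_mul_choose_le_choose_add_choose_sub_s1 (M n t : ℕ) (ht : t ≤ M) :
    2 * M.choose n ≤ (M + t).choose n + (M - t).choose n := by
  induction t with
  | zero => simp [two_mul]
  | succ t ih =>
    obtain ⟨s, rfl⟩ : ∃ s, M = s + t + 1 := ⟨M - t - 1, by omega⟩
    have ih := ih (by omega)
    cases n with
    | zero => simp
    | succ n =>
      have e1 : s + t + 1 - t = s + 1 := by omega
      have e2 : s + t + 1 - (t + 1) = s := by omega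
      rw [e1, Nat.choose_succ_succ' s n] at ih
      rw [e2, ← add_assoc, Nat.choose_succ_succ' (s + t + 1 + t) n]
      have : s.choose n ≤ (s + t + 1 + t).choose n := Nat.choose_mono n (by omega)
      omega

theorem two_mul_choose_le_choose_add_choose (M n a b : ℕ) (h : a + b = 2 * M) :
    2 * M.choose n ≤ a.choose n + b.choose n := by
  rcases le_total M a with hM | hM
  · have := two_mul_choose_le_choose_add_choose_sub_s1 M n (a - M) (by omega)
    rwa [show M + (a - M) = a by omega, show M - (a - M) = b by omega] at this
  · have := two_mul_choose_le_choose_add_choose_sub_s1 M n (b - M) (by omega)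
    rwa [show M + (b - M) = b by omega, show M - (b - M) = a by omega, add_comm] at this

theorem descFactorial_two_mul_le (M n j : ℕ) (hn : n < M) (hj : j ≤ n) :
    ((2 * M).descFactorial j : ℝ) ≤
      2 ^ j * Real.exp (j * (j - 1) / (4 * ((M : ℝ) - n))) * M.descFactorial j := by
  have hMn : (0 : ℝ) < M - n := sub_pos.2 (by exact_mod_cast hn)
  induction j with
  | zero => simp
  | succ j ih =>
    have ih := ih (by omega)
    have hjn : (j : ℝ) ≤ n := by exact_mod_cast (by omega : j ≤ n)
    rw [Nat.descFactorial_succ, Nat.descFactorial_succ]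
    push_cast [Nat.cast_sub (show j ≤ 2 * M by omega), Nat.cast_sub (show j ≤ M by omega)]
    have step : 2 * (M : ℝ) - j ≤ 2 * ((M - j) * Real.exp (j / (2 * ((M : ℝ) - n)))) := by
      have h1 : (j : ℝ) / (2 * ((M : ℝ) - n)) + 1 ≤ Real.exp (j / (2 * ((M : ℝ) - n))) :=
        Real.add_one_le_exp _
      have h2 : (j : ℝ) / 2 ≤ (M - j) * (j / (2 * ((M : ℝ) - n))) := by
        rw [mul_div_assoc', div_le_div_iff₀ (by norm_num) (by positivity)]
        nlinarith [mul_nonneg (Nat.cast_nonneg (α := ℝ) j) (sub_nonneg.2 hjn)]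
      have h3 := mul_le_mul_of_nonneg_left h1 (show (0 : ℝ) ≤ M - j by linarith)
      nlinarith
    have e : Real.exp (((j : ℝ) + 1) * (j + 1 - 1) / (4 * ((M : ℝ) - n))) =
        Real.exp (j / (2 * ((M : ℝ) - n))) * Real.exp (j * (j - 1) / (4 * ((M : ℝ) - n))) := by
      rw [← Real.exp_add]
      congr 1
      field_simp
      ring
    rw [e]
    have hpos : (0 : ℝ) ≤ 2 * (M - j) * Real.exp (j / (2 * ((M : ℝ) - n))) := by
      have : (0 : ℝ) ≤ M - j := by linarith
      positivity
    calc (2 * (M : ℝ) - j) * (2 * M).descFactorial j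
        ≤ (2 * ((M - j) * Real.exp (j / (2 * ((M : ℝ) - n))))) *
          (2 ^ j * Real.exp (j * (j - 1) / (4 * ((M : ℝ) - n))) * M.descFactorial j) := by
          refine mul_le_mul step ih (by positivity) (by linarith)
      _ = _ := by ring

theorem choose_two_mul_le (M n : ℕ) (hn : n < M) :
    ((2 * M).choose n : ℝ) ≤
      2 ^ n * Real.exp (n * (n - 1) / (4 * ((M : ℝ) - n))) * M.choose n := by
  have h := descFactorial_two_mul_le M n n hn le_rfl
  rw [Nat.descFactorial_eq_factorial_mul_choose, Nat.descFactorial_eq_factorial_mul_choose] at h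
  push_cast at h
  refine le_of_mul_le_mul_left (h.trans (le_of_eq ?_))
    (show (0 : ℝ) < n.factorial by exact_mod_cast n.factorial_pos)
  ring

open Finset in
theorem two_mul_choose_le_card_monochromatic {V : Type*} [Fintype V] [DecidableEq V]
    (M n : ℕ) (hn : 0 < n) (hV : Fintype.card V = 2 * M) (c : V → Bool) :
    2 * M.choose n ≤ #{e ∈ powersetCard n (univ : Finset V) |
      ¬ ((∃ v ∈ e, c v = true) ∧ (∃ v ∈ e, c v = false))} := by
  set A : Finset V := {v | c v = true} with hA
  set B : Finset V := {v | ¬ c v = true} with hB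
  have hAB : #A + #B = 2 * M := by
    rw [← hV, ← card_univ]
    exact card_filter_add_card_filter_not _
  have hdisj : Disjoint (powersetCard n A) (powersetCard n B) := by
    rw [disjoint_left]
    intro e heA heB
    rw [mem_powersetCard] at heA heB
    obtain ⟨v, hv⟩ := card_pos.1 (heA.2 ▸ hn)
    exact (mem_filter.1 (heB.1 hv)).2 (mem_filter.1 (heA.1 hv)).2
  calc 2 * M.choose n ≤ (#A).choose n + (#B).choose n :=
        two_mul_choose_le_choose_add_choose M n _ _ hAB
    _ = #(powersetCard n A ∪ powersetCard n B) := by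
        rw [card_union_of_disjoint hdisj, card_powersetCard, card_powersetCard]
    _ ≤ _ := by
        refine card_le_card fun e he => ?_
        rw [mem_filter, mem_powersetCard]
        rw [mem_union, mem_powersetCard, mem_powersetCard] at he
        rcases he with he | he
        · refine ⟨⟨subset_univ _, he.2⟩, ?_⟩
          rintro ⟨-, v, hv, hcv⟩
          have := (mem_filter.1 (he.1 hv)).2
          simp [hcv] at this
        · refine ⟨⟨subset_univ _, he.2⟩, ?_⟩
          rintro ⟨⟨v, hv, hcv⟩, -⟩
          exact (mem_filter.1 (he.1 hv)).2 hcv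

theorem exists_uniform_hypergraph_few_colourings {V : Type*} [Fintype V] [DecidableEq V]
    (M n k : ℕ) (hn : 0 < n) (hnM : n < M) (hV : Fintype.card V = 2 * M) :
    ∃ E : Finset (Finset V), (∀ e ∈ E, e.card = n) ∧ E.card ≤ k ∧
      (Nat.card {c : V → Bool //
        ∀ e ∈ E, (∃ v ∈ e, c v = true) ∧ (∃ v ∈ e, c v = false)} : ℝ) ≤
      2 ^ (2 * M) * Real.exp
        (-(2 / (2 ^ n * Real.exp (n * (n - 1) / (4 * ((M : ℝ) - n))))) * k) := by
  have hcard : (Finset.powersetCard n (Finset.univ : Finset V)).card = (2 * M).choose n := by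
    rw [Finset.card_powersetCard, Finset.card_univ, hV]
  obtain ⟨E, hEP, hEk, hE⟩ := exists_greedy_cover
    (fun (c : V → Bool) e => ¬ ((∃ v ∈ e, c v = true) ∧ (∃ v ∈ e, c v = false)))
    Finset.univ (Finset.powersetCard n (Finset.univ : Finset V))
    (Finset.card_pos.1 (hcard ▸ Nat.choose_pos (by omega)))
    (2 / (2 ^ n * Real.exp (n * (n - 1) / (4 * ((M : ℝ) - n))))) (fun c _ => by
      refine le_trans ?_
        ((Nat.cast_le (α := ℝ)).2 (two_mul_choose_le_card_monochromatic M n hn hV c))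
      push_cast
      rw [hcard, div_mul_eq_mul_div, div_le_iff₀ (by positivity)]
      linarith [choose_two_mul_le M n hnM]) k
  refine ⟨E, fun e he => (Finset.mem_powersetCard.1 (hEP he)).2, hEk, ?_⟩
  rw [Nat.card_eq_fintype_card, Fintype.card_subtype]
  simp only [not_not, Finset.card_univ, Fintype.card_fun, Fintype.card_bool, hV] at hE
  exact_mod_cast hE

/-- For every `ε > 0` there is `N` such that for every even `n ≥ N` there is an `n`-uniform
hypergraph `H₁` on a vertex set of size `n²/2` with at most `(1+ε)·(e·ln 2/8)·n²·2^n` edges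
whose number of proper 2-colourings is at most `2^(n²/4)`. -/
theorem few_proper_colourings :
    ∀ ε : ℝ, 0 < ε → ∃ N : ℕ, ∀ n : ℕ, N ≤ n → Even n →
      ∃ E : Finset (Finset (Fin (n ^ 2 / 2))),
        (∀ e ∈ E, e.card = n) ∧
        (E.card : ℝ) ≤ (1 + ε) * (Real.exp 1 * Real.log 2 / 8) * (n : ℝ) ^ 2 * 2 ^ n ∧
        Nat.card {c : Fin (n ^ 2 / 2) → Bool //
            ∀ e ∈ E, (∃ v ∈ e, c v = true) ∧ (∃ v ∈ e, c v = false)} ≤ 2 ^ (n ^ 2 / 4) := by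
  intro ε hε
  have hlog : 0 < Real.log 2 := Real.log_pos (by norm_num)
  have hexp : Filter.Tendsto (fun m : ℕ => Real.exp (3 / (2 * ((m : ℝ) - 2))))
      Filter.atTop (nhds 1) := by
    rw [← Real.exp_zero]
    refine (Real.continuous_exp.tendsto 0).comp (Filter.Tendsto.const_div_atTop ?_ 3)
    exact (Filter.tendsto_atTop_add_const_right _ (-2) tendsto_natCast_atTop_atTop).const_mul_atTop
      (by norm_num)
  have hlarge : Filter.Tendsto
      (fun m : ℕ => ε / 2 * (Real.exp 1 * Real.log 2 / 2) * (m : ℝ)) Filter.atTop Filter.atTop :=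
    tendsto_natCast_atTop_atTop.const_mul_atTop (by positivity)
  obtain ⟨N, hN⟩ := Filter.eventually_atTop.1
    ((hexp.eventually_le_const (show (1 : ℝ) < 1 + ε / 2 by linarith)).and
      ((hlarge.eventually_ge_atTop 1).and (Filter.eventually_ge_atTop 3)))
  refine ⟨2 * N, fun n hn ⟨m, hm⟩ => ?_⟩
  obtain ⟨h1, h2, h3⟩ := hN m (by omega)
  have hn2 : n = 2 * m := by omega
  have hv : n ^ 2 / 2 = 2 * m ^ 2 := by
    rw [hn2, show (2 * m) ^ 2 = 2 * (2 * m ^ 2) by ring]; omega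
  have hq : n ^ 2 / 4 = m ^ 2 := by
    rw [hn2, show (2 * m) ^ 2 = 4 * m ^ 2 by ring]; omega
  have hm3 : (3 : ℝ) ≤ m := by exact_mod_cast h3
  set X : ℝ := Real.exp 1 * Real.log 2 / 2 * m ^ 2 * 2 ^ n with hX
  have hbound : (1 + ε) * (Real.exp 1 * Real.log 2 / 8) * (n : ℝ) ^ 2 * 2 ^ n = (1 + ε) * X := by
    have : (n : ℝ) = 2 * m := by exact_mod_cast hn2
    rw [hX, this]
    ring
  have hX1 : 1 ≤ ε / 2 * X := by
    have h4 : (1 : ℝ) ≤ m * 2 ^ n :=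
      one_le_mul_of_one_le_of_one_le (by linarith) (one_le_pow₀ (by norm_num))
    calc (1 : ℝ) ≤ (ε / 2 * (Real.exp 1 * Real.log 2 / 2) * m) * (m * 2 ^ n) :=
          one_le_mul_of_one_le_of_one_le h2 h4
      _ = ε / 2 * X := by rw [hX]; ring
  have hX0 : 0 ≤ X := by positivity
  obtain ⟨E, hE, hEk, hEc⟩ := exists_uniform_hypergraph_few_colourings
    (V := Fin (n ^ 2 / 2)) (m ^ 2) n ⌊(1 + ε) * X⌋₊ (by omega) (by rw [hn2]; nlinarith)
    (by rw [Fintype.card_fin, hv])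
  refine ⟨E, hE, ?_, ?_⟩
  · rw [hbound]
    exact (Nat.cast_le.2 hEk).trans (Nat.floor_le (by positivity))
  · rw [hq, ← Nat.cast_le (α := ℝ)]
    refine hEc.trans ?_
    have hfloor := Nat.lt_floor_add_one ((1 + ε) * X)
    set k : ℝ := (⌊(1 + ε) * X⌋₊ : ℝ)
    have hsplit : Real.exp ((n : ℝ) * (n - 1) / (4 * (((m ^ 2 : ℕ) : ℝ) - n))) =
        Real.exp 1 * Real.exp (3 / (2 * ((m : ℝ) - 2))) := by
      have h0 : (m : ℝ) - 2 ≠ 0 := by linarith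
      have h0' : (m : ℝ) ≠ 0 := by linarith
      rw [← Real.exp_add, hn2]
      congr 1
      push_cast
      rw [show (m : ℝ) ^ 2 - 2 * m = m * (m - 2) by ring]
      field_simp
      ring
    have hk : X * Real.exp (3 / (2 * ((m : ℝ) - 2))) ≤ k := by
      have := mul_le_mul_of_nonneg_left h1 hX0
      nlinarith
    have hkey : Real.log 2 * m ^ 2 ≤
        2 / (2 ^ n * (Real.exp 1 * Real.exp (3 / (2 * ((m : ℝ) - 2))))) * k := by
      rw [div_mul_eq_mul_div, le_div_iff₀ (by positivity)]
      calc _ = 2 * (X * Real.exp (3 / (2 * ((m : ℝ) - 2)))) := by rw [hX]; ring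
        _ ≤ _ := by linarith
    rw [hsplit]
    calc _ ≤ (2 : ℝ) ^ (2 * m ^ 2) * Real.exp (-(Real.log 2 * m ^ 2)) := by
          gcongr
          linarith
      _ = ((2 ^ m ^ 2 : ℕ) : ℝ) := by
          have : Real.exp (Real.log 2 * m ^ 2) = 2 ^ m ^ 2 := by
            rw [← Nat.cast_pow, mul_comm, Real.exp_nat_mul, Real.exp_log (by norm_num)]
          rw [Real.exp_neg, this, two_mul, pow_add]
          push_cast
          field_simp
end

section
/- Let H = (V, E) be a hypergraph on a finite vertex set V with |V| = v ≥ 3, and let P be the number of proper 2-colourings of H. Then there exists a hypergraph H' = (V, E') with E ⊆ E' such that every edge of E' \ E has cardinality exactly ⌈v/2⌉, the number of edges in E' \ E is at most P, and H' admits no proper 2-colouring. Consequently q(H') ≤ q(H) + P · 2^{-⌈v/2⌉}. -/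
theorem exists_monochromatic_card_eq_half {V : Type*} [Fintype V] (c : V → Bool) :
    ∃ s : Finset V, s.card = (Fintype.card V + 1) / 2 ∧ ∀ x ∈ s, ∀ y ∈ s, c x = c y := by
  classical
  have hsum := Finset.card_filter_add_card_filter_not (s := (Finset.univ : Finset V))
    (fun x => c x = true)
  rw [Finset.card_univ] at hsum
  obtain h | h : (Fintype.card V + 1) / 2 ≤ (Finset.univ.filter (fun x => c x = true)).card ∨
      (Fintype.card V + 1) / 2 ≤ (Finset.univ.filter (fun x => ¬ c x = true)).card := by omega
  all_goals
    obtain ⟨s, hs, hcard⟩ := Finset.exists_subset_card_eq h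
    refine ⟨s, hcard, fun x hx y hy => ?_⟩
    have hcx := (Finset.mem_filter.mp (hs hx)).2
    have hcy := (Finset.mem_filter.mp (hs hy)).2
    simp_all


/-- Completing a hypergraph to a non-2-colourable one: if `H = (V, E)` has `v = |V| ≥ 3`
vertices and `P` proper 2-colourings, then there is `E' ⊇ E` such that all edges of
`E' \ E` have size `⌈v/2⌉`, `|E' \ E| ≤ P`, `(V, E')` has no proper 2-colouring, and
`q(H') ≤ q(H) + P · 2^{-⌈v/2⌉}`. -/
theorem complete_to_non_colourable (V : Type) [Fintype V] [DecidableEq V]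
    (E : Finset (Finset V)) (v : ℕ) (hv : v = Fintype.card V) (hv3 : 3 ≤ v)
    (P : ℕ)
    (hP : P = Nat.card {c : V → Bool //
        ∀ e ∈ E, (∃ x ∈ e, c x = true) ∧ (∃ x ∈ e, c x = false)}) :
    ∃ E' : Finset (Finset V),
      E ⊆ E' ∧
      (∀ e ∈ E' \ E, e.card = (v + 1) / 2) ∧
      (E' \ E).card ≤ P ∧
      (∀ c : V → Bool, ∃ e ∈ E', ∀ x ∈ e, ∀ y ∈ e, c x = c y) ∧
      ∑ e ∈ E', ((2 : ℝ) ^ e.card)⁻¹ ≤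
        ∑ e ∈ E, ((2 : ℝ) ^ e.card)⁻¹ + (P : ℝ) * ((2 : ℝ) ^ ((v + 1) / 2))⁻¹ := by
  classical
  subst hv
  choose f hf_card hf_mono using exists_monochromatic_card_eq_half (V := V)
  let proper : Finset (V → Bool) := Finset.univ.filter fun c =>
    ∀ e ∈ E, (∃ x ∈ e, c x = true) ∧ (∃ x ∈ e, c x = false)
  have hP' : P = proper.card := by
    rw [hP, Nat.card_eq_fintype_card, Fintype.card_subtype]
  have hsub : (E ∪ proper.image f) \ E ⊆ proper.image f := by
    rw [Finset.union_sdiff_left]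
    exact Finset.sdiff_subset
  have hcard : ∀ e ∈ (E ∪ proper.image f) \ E, e.card = (Fintype.card V + 1) / 2 := by
    intro e he
    obtain ⟨c, -, rfl⟩ := Finset.mem_image.mp (hsub he)
    exact hf_card c
  have hle : ((E ∪ proper.image f) \ E).card ≤ P :=
    hP' ▸ (Finset.card_le_card hsub).trans Finset.card_image_le
  refine ⟨E ∪ proper.image f, Finset.subset_union_left, hcard, hle, fun c => ?_, ?_⟩
  · by_cases hc : c ∈ proper
    · exact ⟨f c, Finset.mem_union_right _ (Finset.mem_image_of_mem f hc), hf_mono c⟩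
    · obtain ⟨e, he, hmono⟩ : ∃ e ∈ E, ¬ ((∃ x ∈ e, c x = true) ∧ (∃ x ∈ e, c x = false)) := by
        simpa only [proper, Finset.mem_filter, Finset.mem_univ, true_and, not_forall,
          exists_prop] using hc
      refine ⟨e, Finset.mem_union_left _ he, fun x hx y hy => ?_⟩
      by_contra hxy
      apply hmono
      cases hcx : c x <;> cases hcy : c y <;> simp_all
      · exact ⟨⟨y, hy, hcy⟩, ⟨x, hx, hcx⟩⟩
      · exact ⟨⟨x, hx, hcx⟩, ⟨y, hy, hcy⟩⟩
  · rw [← Finset.sum_sdiff (Finset.subset_union_left (s₁ := E) (s₂ := proper.image f)), add_comm]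
    gcongr
    rw [Finset.sum_congr rfl fun e he => by rw [hcard e he], Finset.sum_const, nsmul_eq_mul]
    gcongr
end

section
/- Let v be an even positive integer, let n be a positive integer with 2 ≤ n ≤ v/2, let m be a positive integer, and set q = 2 · C(v/2, n) / C(v, n), where C denotes the binomial coefficient. Then there exists a hypergraph on a v-element vertex set with at most m edges, each edge of cardinality exactly n, such that the number of proper 2-colourings of this hypergraph is at most 2^v · (1 − q)^m. -/
/-- `x ↦ x.choose n` has increasing differences. -/
theorem choose_add_add_choose_le (n d : ℕ) {x y : ℕ} (hxy : x ≤ y) :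
    (x + d).choose n + y.choose n ≤ x.choose n + (y + d).choose n := by
  induction d with
  | zero => simp
  | succ d ih =>
    cases n with
    | zero => simp
    | succ n =>
      have h := Nat.choose_le_choose n (Nat.add_le_add_right hxy d)
      rw [← Nat.add_assoc, ← Nat.add_assoc, Nat.choose_succ_succ', Nat.choose_succ_succ' (y + d)]
      omega

/-- Midpoint convexity of `x ↦ x.choose n`. -/
theorem two_mul_choose_half_le {a b v : ℕ} (n : ℕ) (hv : Even v) (hab : a + b = v) :
    2 * (v / 2).choose n ≤ a.choose n + b.choose n := by
  wlog h : a ≤ b generalizing a b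
  · rw [Nat.add_comm (a.choose n)]
    exact this (by omega) (by omega)
  obtain ⟨k, rfl⟩ := hv
  obtain ⟨d, rfl⟩ : ∃ d, k = a + d := ⟨k - a, by omega⟩
  obtain rfl : b = a + d + d := by omega
  have hk := choose_add_add_choose_le n d (Nat.le_add_right a d)
  have hhalf : (a + d + (a + d)) / 2 = a + d := by omega
  rw [hhalf]
  omega

/-- The edge `e` contains vertices of both colours under `c`. -/
def IsBichromatic {V : Type*} (c : V → Bool) (e : Finset V) : Prop :=
  (∃ x ∈ e, c x = true) ∧ (∃ x ∈ e, c x = false)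

open Classical in
/-- Any colouring of an even number of vertices has at least `2 * C(v/2, n)` monochromatic
`n`-sets. -/
theorem card_bichromatic_add_le {V : Type*} [Fintype V] {n : ℕ} (hn : n ≠ 0)
    (hV : Even (Fintype.card V)) (c : V → Bool) :
    ((Finset.univ.powersetCard n).filter (IsBichromatic c)).card
      + 2 * (Fintype.card V / 2).choose n ≤ (Fintype.card V).choose n := by
  set T := Finset.univ.filter fun x => c x = true
  set F := Finset.univ.filter fun x => ¬ c x = true
  have hTF : T.card + F.card = Fintype.card V :=
    Finset.card_filter_add_card_filter_not fun x => c x = true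
  have hdisj : Disjoint (T.powersetCard n) (F.powersetCard n) := by
    rw [Finset.disjoint_left]
    intro e heT heF
    rw [Finset.mem_powersetCard] at heT heF
    obtain ⟨x, hx⟩ := Finset.card_ne_zero.mp (heT.2 ▸ hn)
    exact (Finset.mem_filter.mp (heF.1 hx)).2 (Finset.mem_filter.mp (heT.1 hx)).2
  have hsub : T.powersetCard n ∪ F.powersetCard n ⊆
      (Finset.univ.powersetCard n).filter fun e => ¬ IsBichromatic c e := by
    intro e he
    rw [Finset.mem_filter, Finset.mem_powersetCard]
    rcases Finset.mem_union.mp he with he | he <;> rw [Finset.mem_powersetCard] at he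
    · refine ⟨⟨Finset.subset_univ e, he.2⟩, fun ⟨_, x, hx, hc⟩ => ?_⟩
      simpa [T, hc] using he.1 hx
    · refine ⟨⟨Finset.subset_univ e, he.2⟩, fun ⟨⟨x, hx, hc⟩, _⟩ => ?_⟩
      simpa [F, hc] using he.1 hx
  have hmono := Finset.card_le_card hsub
  rw [Finset.card_union_of_disjoint hdisj, Finset.card_powersetCard,
    Finset.card_powersetCard] at hmono
  have htotal := Finset.card_filter_add_card_filter_not (s := Finset.univ.powersetCard n)
    (IsBichromatic c)
  rw [Finset.card_powersetCard, Finset.card_univ] at htotal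
  have hconv := two_mul_choose_half_le n hV hTF
  omega

open Classical in
/-- Averaging over all `n`-sets, some `n`-set is bichromatic for at most a proportion
`1 - 2 * C(v/2, n) / C(v, n)` of any given family of colourings. -/
theorem exists_edge_card_bichromatic_le {V : Type*} [Fintype V] {n : ℕ} (hn : n ≠ 0)
    (hV : Even (Fintype.card V)) (hnV : n ≤ Fintype.card V) (S : Finset (V → Bool)) :
    ∃ e : Finset V, e.card = n ∧ ((S.filter fun c => IsBichromatic c e).card : ℝ) ≤
      S.card * (1 - 2 * ((Fintype.card V / 2).choose n : ℝ) / ((Fintype.card V).choose n : ℝ)) := by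
  set N := (Fintype.card V).choose n
  set h := (Fintype.card V / 2).choose n
  have hNpos : (0 : ℝ) < N := by exact_mod_cast Nat.choose_pos hnV
  have hcard : (Finset.univ.powersetCard n : Finset (Finset V)).card = N := by
    rw [Finset.card_powersetCard, Finset.card_univ]
  have hne : (Finset.univ.powersetCard n : Finset (Finset V)).Nonempty :=
    Finset.powersetCard_nonempty.mpr hnV
  have hdouble := Finset.sum_card_bipartiteAbove_eq_sum_card_bipartiteBelow
    (s := S) (t := Finset.univ.powersetCard n) (IsBichromatic (V := V))
  have hle : ∑ e ∈ Finset.univ.powersetCard n,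
      ((S.filter fun c => IsBichromatic c e).card : ℝ) ≤
      ∑ _e ∈ (Finset.univ.powersetCard n : Finset (Finset V)),
        (S.card : ℝ) * (1 - 2 * (h : ℝ) / (N : ℝ)) := by
    calc ∑ e ∈ Finset.univ.powersetCard n, ((S.filter fun c => IsBichromatic c e).card : ℝ)
        = ∑ c ∈ S, (((Finset.univ.powersetCard n).filter (IsBichromatic c)).card : ℝ) := by
          exact_mod_cast hdouble.symm
      _ ≤ ∑ _c ∈ S, ((N : ℝ) - 2 * h) := by
          refine Finset.sum_le_sum fun c _ => le_sub_iff_add_le.mpr ?_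
          exact_mod_cast card_bichromatic_add_le hn hV c
      _ = _ := by
          rw [Finset.sum_const, Finset.sum_const, hcard, nsmul_eq_mul, nsmul_eq_mul]
          field_simp
  obtain ⟨e, he, hbound⟩ := Finset.exists_le_of_sum_le hne hle
  exact ⟨e, (Finset.mem_powersetCard.mp he).2, hbound⟩

open Classical in
/-- Choosing edges greedily gives an `n`-uniform hypergraph with few proper colourings. -/
theorem exists_hypergraph_card_proper_le {V : Type*} [Fintype V] {n : ℕ} (hn : n ≠ 0)
    (hV : Even (Fintype.card V)) (hnV : n ≤ Fintype.card V) (m : ℕ) :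
    ∃ E : Finset (Finset V), E.card ≤ m ∧ (∀ e ∈ E, e.card = n) ∧
      ((Finset.univ.filter fun c : V → Bool => ∀ e ∈ E, IsBichromatic c e).card : ℝ) ≤
        2 ^ Fintype.card V *
          (1 - 2 * ((Fintype.card V / 2).choose n : ℝ) / ((Fintype.card V).choose n : ℝ)) ^ m := by
  have hp : (0 : ℝ) ≤
      1 - 2 * ((Fintype.card V / 2).choose n : ℝ) / ((Fintype.card V).choose n : ℝ) := by
    refine sub_nonneg.mpr (div_le_one_of_le₀ ?_ (Nat.cast_nonneg _))
    exact_mod_cast le_of_add_le_right (card_bichromatic_add_le hn hV fun _ => true)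
  induction m with
  | zero => exact ⟨∅, by simp⟩
  | succ m ih =>
    obtain ⟨E, hEm, hEn, hE⟩ := ih
    obtain ⟨e, hen, he⟩ := exists_edge_card_bichromatic_le hn hV hnV
      (Finset.univ.filter fun c : V → Bool => ∀ e ∈ E, IsBichromatic c e)
    refine ⟨insert e E, (Finset.card_insert_le e E).trans (by omega), ?_, ?_⟩
    · simpa [hen] using hEn
    · rw [pow_succ, ← mul_assoc]
      refine le_trans (le_of_eq ?_) (he.trans (mul_le_mul_of_nonneg_right hE hp))
      rw [Finset.filter_filter]
      simp only [Finset.forall_mem_insert, and_comm]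

/-- First-moment bound: for even `v > 0`, `2 ≤ n ≤ v/2`, `m > 0` and
`q = 2·C(v/2,n)/C(v,n)`, there is a hypergraph on `v` vertices with at most `m` edges,
each of size `n`, having at most `2^v · (1 - q)^m` proper 2-colourings. -/
theorem random_hypergraph_few_colourings (v n m : ℕ) (hv : Even v) (hv0 : 0 < v)
    (hn2 : 2 ≤ n) (hnv : n ≤ v / 2) (hm : 0 < m)
    (q : ℝ) (hq : q = 2 * (Nat.choose (v / 2) n : ℝ) / (Nat.choose v n : ℝ)) :
    ∃ E : Finset (Finset (Fin v)),
      E.card ≤ m ∧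
      (∀ e ∈ E, e.card = n) ∧
      (Nat.card {c : Fin v → Bool //
          ∀ e ∈ E, (∃ x ∈ e, c x = true) ∧ (∃ x ∈ e, c x = false)} : ℝ) ≤
        2 ^ v * (1 - q) ^ m := by
  classical
  obtain ⟨E, hEm, hEn, hE⟩ := exists_hypergraph_card_proper_le (V := Fin v) (n := n) (by omega)
    (by simpa using hv) (by simp only [Fintype.card_fin]; omega) m
  refine ⟨E, hEm, hEn, ?_⟩
  rw [Fintype.card_fin, ← hq] at hE
  rw [Nat.card_eq_fintype_card, Fintype.card_subtype]
  unfold IsBichromatic at hE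
  convert hE
end

section
/- The limit, as the positive integer k tends to infinity, of 4^k · C(k², 2k) / C(2k², 2k) equals 1/e, where C denotes the binomial coefficient and e is Euler's number. (Equivalently, writing n = 2k and v = n²/2, the quantity q = 2 · C(v/2, n)/C(v, n) satisfies q = (1 + o(1)) · 2/(e · 2^n).) -/
theorem two_pow_mul_choose_div_choose {n N : ℕ} (h : n ≤ N) :
    (2 : ℝ) ^ n * (N.choose n : ℝ) / ((2 * N).choose n : ℝ) =
      ∏ i ∈ Finset.range n, (2 * (N - i : ℝ)) / (2 * N - i) := by
  have cast_choose (M : ℕ) (hM : n ≤ M) :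
      (n.factorial : ℝ) * (M.choose n : ℝ) = ∏ i ∈ Finset.range n, (M - i : ℝ) := by
    rw [← Nat.cast_mul, ← Nat.descFactorial_eq_factorial_mul_choose,
      Nat.descFactorial_eq_prod_range, Nat.cast_prod]
    refine Finset.prod_congr rfl fun i hi => ?_
    rw [Nat.cast_sub ((Finset.mem_range.mp hi).le.trans hM)]
  have hf : (n.factorial : ℝ) ≠ 0 := by positivity
  have h₂ := cast_choose (2 * N) (by omega)
  push_cast at h₂
  rw [Finset.prod_div_distrib, Finset.prod_mul_distrib, Finset.prod_const, Finset.card_range,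
    ← cast_choose N h, ← h₂, mul_left_comm, mul_div_mul_left _ _ hf]

theorem two_pow_mul_choose_div_choose_le {n N : ℕ} (h : n ≤ N) :
    (2 : ℝ) ^ n * (N.choose n : ℝ) / ((2 * N).choose n : ℝ) ≤
      Real.exp (-((∑ i ∈ Finset.range n, (i : ℝ)) / (2 * N))) := by
  rw [two_pow_mul_choose_div_choose h, Finset.sum_div, ← Finset.sum_neg_distrib, Real.exp_sum]
  have key (i : ℕ) (hi : i ∈ Finset.range n) : (i : ℝ) < N := by
    exact_mod_cast (Finset.mem_range.mp hi).trans_le h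
  refine Finset.prod_le_prod (fun i hi => ?_) fun i hi => ?_
  · have := key i hi
    have hi0 : (0 : ℝ) ≤ i := i.cast_nonneg
    exact div_nonneg (by linarith) (by linarith)
  · have := key i hi
    have hi0 : (0 : ℝ) ≤ i := i.cast_nonneg
    refine le_trans ?_ (Real.one_sub_le_exp_neg _)
    rw [one_sub_div (by linarith), div_le_div_iff₀ (by linarith) (by linarith)]
    nlinarith

theorem le_two_pow_mul_choose_div_choose {n N : ℕ} (h : n < N) :
    Real.exp (-((∑ i ∈ Finset.range n, (i : ℝ)) / (2 * (N - n)))) ≤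
      (2 : ℝ) ^ n * (N.choose n : ℝ) / ((2 * N).choose n : ℝ) := by
  rw [two_pow_mul_choose_div_choose h.le, Finset.sum_div, ← Finset.sum_neg_distrib, Real.exp_sum]
  refine Finset.prod_le_prod (fun i _ => (Real.exp_pos _).le) fun i hi => ?_
  have hin : (i : ℝ) < n := by exact_mod_cast Finset.mem_range.mp hi
  have hnN : (n : ℝ) < N := by exact_mod_cast h
  have hi0 : (0 : ℝ) ≤ i := i.cast_nonneg
  rw [Real.exp_neg, ← inv_div (2 * (N : ℝ) - i)]
  refine inv_anti₀ (div_pos (by linarith) (by linarith)) ?_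
  refine le_trans ?_ (Real.add_one_le_exp _)
  rw [div_add_one (by linarith), div_le_div_iff₀ (by linarith) (by linarith)]
  nlinarith [mul_nonneg hi0 (sub_nonneg.2 hin.le)]

open Filter in
/-- `4^k · C(k², 2k) / C(2k², 2k) → 1/e` as `k → ∞`; equivalently, with `n = 2k` and
`v = n²/2`, the quantity `q = 2·C(v/2, n)/C(v, n)` satisfies `q = (1+o(1)) · 2/(e·2^n)`. -/
theorem choose_ratio_tendsto_inv_e :
    Tendsto (fun k : ℕ =>
        (4 : ℝ) ^ k * (Nat.choose (k ^ 2) (2 * k) : ℝ) / (Nat.choose (2 * k ^ 2) (2 * k) : ℝ))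
      atTop (nhds (Real.exp 1)⁻¹) := by
  have hsum (k : ℕ) : ∑ i ∈ Finset.range (2 * k), (i : ℝ) = k * (2 * k - 1) := by
    induction k with
    | zero => simp
    | succ k ih =>
      rw [mul_add, mul_one, Finset.sum_range_succ, Finset.sum_range_succ, ih]
      push_cast
      ring
  have hpow (k : ℕ) : (4 : ℝ) ^ k = 2 ^ (2 * k) := by
    rw [pow_mul]
    norm_num
  have hlt {k : ℕ} (hk : 3 ≤ k) : 2 * k < k ^ 2 := by nlinarith
  have hk_top : Tendsto (fun k : ℕ => (k : ℝ)) atTop atTop := tendsto_natCast_atTop_atTop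
  have hlow : Tendsto (fun k : ℕ => Real.exp (-(1 + 3 / (2 * ((k : ℝ) - 2))))) atTop
      (nhds (Real.exp 1)⁻¹) := by
    rw [← Real.exp_neg]
    refine (Real.continuous_exp.tendsto _).comp (Tendsto.neg ?_)
    have hden : Tendsto (fun k : ℕ => 2 * ((k : ℝ) - 2)) atTop atTop :=
      (tendsto_atTop_add_const_right _ (-2) hk_top).const_mul_atTop two_pos
    simpa using (hden.const_div_atTop 3).const_add 1
  have hupp : Tendsto (fun k : ℕ => Real.exp (-(1 - 1 / (2 * (k : ℝ))))) atTop
      (nhds (Real.exp 1)⁻¹) := by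
    rw [← Real.exp_neg]
    refine (Real.continuous_exp.tendsto _).comp (Tendsto.neg ?_)
    simpa using ((hk_top.const_mul_atTop two_pos).const_div_atTop 1).const_sub 1
  refine tendsto_of_tendsto_of_tendsto_of_le_of_le' hlow hupp ?_ ?_
  · filter_upwards [eventually_ge_atTop 3] with k hk
    have hk' : (3 : ℝ) ≤ k := by exact_mod_cast hk
    rw [hpow]
    convert! le_two_pow_mul_choose_div_choose (hlt hk) using 3
    rw [hsum]
    push_cast
    have h₁ : (k : ℝ) - 2 ≠ 0 := by linarith
    have h₂ : (k : ℝ) ≠ 0 := by linarith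
    rw [show (k : ℝ) ^ 2 - 2 * k = k * (k - 2) by ring]
    field_simp
    ring
  · filter_upwards [eventually_ge_atTop 3] with k hk
    have hk' : (3 : ℝ) ≤ k := by exact_mod_cast hk
    rw [hpow]
    convert! two_pow_mul_choose_div_choose_le (hlt hk).le using 3
    rw [hsum]
    push_cast
    have h₂ : (k : ℝ) ≠ 0 := by linarith
    field_simp
end

section
/- There exists a hypergraph H on a vertex set of 16 elements whose edge set consists of exactly 20 edges of cardinality 4 and exactly 60 edges of cardinality 8, such that H admits no proper 2-colouring. Consequently q(H) = 20 · 2^{-4} + 60 · 2^{-8} = 95/64, and 23/16 < 95/64 < 24/16. -/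
/-- The set of positions of the nonzero binary digits of `m`. -/
def bitSupport (m : ℕ) : Finset (Fin 16) := Finset.univ.filter fun i => m.testBit i

/-- The 20 lines of the affine plane over `𝔽₄`, written in binary: the point `(x, y)` is
bit number `4 * x + y`. -/
def affineLines : List ℕ :=
  [15, 240, 3840, 4369, 4680, 5250, 6180, 8580, 8738, 9240, 10305, 16680, 17025, 17476, 18450,
   33090, 33300, 33825, 34952, 61440]

/-- The 60 sets that contain the point `(0, 0)` and neither contain nor miss a line of the affine
plane, written in binary. -/
def blockingSets : List ℕ :=
  [4791, 5245, 5931, 6363, 7053, 7495, 7905, 8571, 8925, 9447, 10161, 11031, 11565, 11915,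
   13251, 15411, 16855, 17595, 18205, 18669, 19275, 19825, 20007, 21925, 23125, 26217, 27033,
   29005, 29211, 29905, 30855, 31521, 33213, 33515, 34695, 34935, 35793, 36123, 36429, 38553,
   39273, 42325, 43685, 45351, 45681, 46155, 47133, 48513, 49971, 52419, 53643, 53805, 54295,
   55105, 55473, 57825, 57927, 58509, 59435, 60945]

/-- The edges of the hypergraph, written in binary. -/
def edgeCodes : List ℕ := affineLines ++ blockingSets

/-- The edges of the hypergraph. -/
def planeEdges : Finset (Finset (Fin 16)) := edgeCodes.toFinset.image bitSupport

theorem injOn_bitSupport : Set.InjOn bitSupport {m | m < 2 ^ 16} := by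
  intro m hm n hn h
  refine Nat.eq_of_testBit_eq fun i => ?_
  by_cases hi : i < 16
  · have := Finset.ext_iff.1 h ⟨i, hi⟩
    rw [bitSupport, bitSupport, Finset.mem_filter_univ, Finset.mem_filter_univ] at this
    exact Bool.eq_iff_iff.2 this
  · have hle : 2 ^ 16 ≤ 2 ^ i := Nat.pow_le_pow_right two_pos (not_lt.1 hi)
    rw [Nat.testBit_lt_two_pow (lt_of_lt_of_le hm hle),
      Nat.testBit_lt_two_pow (lt_of_lt_of_le hn hle)]

theorem card_filter_planeEdges (k : ℕ) : (planeEdges.filter fun e => e.card = k).card =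
    (edgeCodes.filter fun m => (bitSupport m).card = k).length := by
  have hlt : ∀ m ∈ edgeCodes, m < 2 ^ 16 := by decide +kernel
  have hnodup : edgeCodes.Nodup := by decide +kernel
  rw [planeEdges, Finset.filter_image, Finset.card_image_of_injOn,
    ← List.toFinset_card_of_nodup (hnodup.filter _), List.toFinset_filter]
  · simp
  · refine injOn_bitSupport.mono fun m hm => hlt m ?_
    simpa using (Finset.mem_filter.1 hm).1

theorem card_filter_planeEdges_four : (planeEdges.filter fun e => e.card = 4).card = 20 := by
  rw [card_filter_planeEdges]
  decide +kernel

theorem card_filter_planeEdges_eight : (planeEdges.filter fun e => e.card = 8).card = 60 := by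
  rw [card_filter_planeEdges]
  decide +kernel

theorem card_of_mem_planeEdges : ∀ e ∈ planeEdges, e.card = 4 ∨ e.card = 8 := by
  have h : ∀ m ∈ edgeCodes, (bitSupport m).card = 4 ∨ (bitSupport m).card = 8 := by
    decide +kernel
  exact Finset.forall_mem_image.2 fun m hm => h m (List.mem_toFinset.1 hm)

/-- Whether one of the codes in `es` is less than `2 ^ k` and has a support on which the binary
digits of `m` are constant. -/
def hasMonochromatic (es : List ℕ) (k m : ℕ) : Bool :=
  es.any fun e =>
    Nat.blt e (2 ^ k) && (Nat.beq (Nat.land m e) 0 || Nat.beq (Nat.land m e) e)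

/-- Backtracking search over the digits from `k` upwards of the numbers congruent to `m` modulo
`2 ^ k`: the branches chosen at digit `k + i` are closed by the codes in the `i`-th list. -/
def covers : List (List ℕ) → ℕ → ℕ → Bool
  | [], _, _ => false
  | es :: l, k, m =>
    (hasMonochromatic es (k + 1) m || covers l (k + 1) m) &&
    (hasMonochromatic es (k + 1) (m + 2 ^ k) || covers l (k + 1) (m + 2 ^ k))

theorem mod_two_pow_land {e k : ℕ} (x : ℕ) (he : e < 2 ^ k) : (x % 2 ^ k) &&& e = x &&& e := by
  refine Nat.eq_of_testBit_eq fun i => ?_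
  by_cases hi : i < k
  · simp [Nat.testBit_mod_two_pow, hi]
  · simp [Nat.testBit_lt_two_pow
      (lt_of_lt_of_le he (Nat.pow_le_pow_right two_pos (not_lt.1 hi)))]

theorem exists_land_eq_of_hasMonochromatic {es : List ℕ} {k x : ℕ}
    (h : hasMonochromatic es k (x % 2 ^ k) = true) :
    ∃ e ∈ es, x &&& e = 0 ∨ x &&& e = e := by
  obtain ⟨e, he, h⟩ := List.any_eq_true.1 h
  rw [Bool.and_eq_true, Bool.or_eq_true, Nat.blt_eq, Nat.beq_eq, Nat.beq_eq] at h
  refine ⟨e, he, ?_⟩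
  rw [← mod_two_pow_land x h.1]
  exact h.2

theorem exists_land_eq_of_covers {l : List (List ℕ)} {k x : ℕ}
    (h : covers l k (x % 2 ^ k) = true) :
    ∃ es ∈ l, ∃ e ∈ es, x &&& e = 0 ∨ x &&& e = e := by
  induction l generalizing k with
  | nil => simp [covers] at h
  | cons es l ih =>
    have hstep : hasMonochromatic es (k + 1) (x % 2 ^ (k + 1)) = true ∨
        covers l (k + 1) (x % 2 ^ (k + 1)) = true := by
      rw [covers, Bool.and_eq_true, Bool.or_eq_true, Bool.or_eq_true] at h
      rw [Nat.mod_pow_succ]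
      rcases Nat.mod_two_eq_zero_or_one (x / 2 ^ k) with hk | hk
      · simpa [hk] using h.1
      · simpa [hk] using h.2
    rcases hstep with h | h
    · exact ⟨es, List.mem_cons_self, exists_land_eq_of_hasMonochromatic h⟩
    · obtain ⟨fs, hfs, h⟩ := ih h
      exact ⟨fs, List.mem_cons_of_mem _ hfs, h⟩

theorem covers_edgeCodes :
    covers ((List.range 16).map fun k => edgeCodes.filter fun e => Nat.log2 e == k) 0 0 = true := by
  decide +kernel

/-- The binary digits of every number are constant on the support of one of the edges. -/
theorem exists_mem_edgeCodes_land_eq (x : ℕ) :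
    ∃ e ∈ edgeCodes, x &&& e = 0 ∨ x &&& e = e := by
  obtain ⟨es, hes, e, he, h⟩ := exists_land_eq_of_covers (x := x) (k := 0)
    (by simpa [Nat.mod_one] using covers_edgeCodes)
  obtain ⟨k, -, rfl⟩ := List.mem_map.1 hes
  exact ⟨e, List.mem_of_mem_filter he, h⟩

theorem exists_monochromatic_mem_planeEdges (c : Fin 16 → Bool) :
    ∃ e ∈ planeEdges, ∀ v ∈ e, ∀ w ∈ e, c v = c w := by
  obtain ⟨m, hm, h⟩ := exists_mem_edgeCodes_land_eq (Nat.ofBits c)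
  have hbit (v : Fin 16) (hv : v ∈ bitSupport m) :
      (Nat.ofBits c &&& m).testBit v = c v := by
    have hv : m.testBit v = true := by simpa [bitSupport] using hv
    simp [Nat.testBit_and, hv]
  refine ⟨bitSupport m, Finset.mem_image_of_mem _ (List.mem_toFinset.2 hm), fun v hv w hw => ?_⟩
  rw [← hbit v hv, ← hbit w hw]
  simp only [bitSupport, Finset.mem_filter, Finset.mem_univ, true_and] at hv hw
  rcases h with h | h <;> simp [h, hv, hw]

theorem sum_planeEdges : ∑ e ∈ planeEdges, ((2 : ℝ) ^ e.card)⁻¹ = 95 / 64 := by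
  have hnot : (planeEdges.filter fun e => ¬ e.card = 4) =
      planeEdges.filter fun e => e.card = 8 :=
    Finset.filter_congr fun e he => by have := card_of_mem_planeEdges e he; omega
  rw [← Finset.sum_filter_add_sum_filter_not planeEdges (fun e => e.card = 4), hnot,
    Finset.sum_congr rfl (g := fun _ => ((2 : ℝ) ^ 4)⁻¹)
      fun e he => by rw [(Finset.mem_filter.1 he).2],
    Finset.sum_congr (s₁ := planeEdges.filter fun e => e.card = 8) rfl
      (g := fun _ => ((2 : ℝ) ^ 8)⁻¹) fun e he => by rw [(Finset.mem_filter.1 he).2],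
    Finset.sum_const, Finset.sum_const, card_filter_planeEdges_four,
    card_filter_planeEdges_eight]
  norm_num


/-- There is a non-2-colourable hypergraph on 16 vertices with exactly 20 edges of size 4
and exactly 60 edges of size 8 (and no other edges), so that
`q(H) = 20·2^{-4} + 60·2^{-8} = 95/64`, and `23/16 < 95/64 < 24/16`. -/
theorem hypergraph_16_vertices :
    (∃ E : Finset (Finset (Fin 16)),
      (E.filter fun e => e.card = 4).card = 20 ∧
      (E.filter fun e => e.card = 8).card = 60 ∧
      (∀ e ∈ E, e.card = 4 ∨ e.card = 8) ∧
      (∀ c : Fin 16 → Bool, ∃ e ∈ E, ∀ v ∈ e, ∀ w ∈ e, c v = c w) ∧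
      ∑ e ∈ E, ((2 : ℝ) ^ e.card)⁻¹ = 95 / 64) ∧
    (20 * ((2 : ℝ) ^ 4)⁻¹ + 60 * ((2 : ℝ) ^ 8)⁻¹ = 95 / 64) ∧
    ((23 : ℝ) / 16 < 95 / 64 ∧ (95 : ℝ) / 64 < 24 / 16) := by
  refine ⟨⟨planeEdges, card_filter_planeEdges_four, card_filter_planeEdges_eight,
    card_of_mem_planeEdges, exists_monochromatic_mem_planeEdges, sum_planeEdges⟩, ?_, ?_, ?_⟩ <;>
  norm_num
end

section
/- Let F be the field with four elements (GaloisField 2 2) and let V = F × F, a set of 16 points. Let the edges be all affine lines of the plane V, i.e., all sets of the form {p + t • d : t ∈ F} for p ∈ V and nonzero d ∈ V (each line has exactly 4 points, and there are exactly 20 distinct lines). Then the number of functions c : V → Bool under which no line is monochromatic is exactly 120. -/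
namespace Hypergraph

variable {α : Type*}

/-- A demand `(b, s)` asks that some vertex of `s` has colour `b`. -/
def Meets (x : α → Bool) (ds : List (Bool × List α)) : Prop :=
  ∀ d ∈ ds, ∃ v ∈ d.2, x v = d.1

/-- A vertex on which to branch: from a demand that leaves no choice if there is one, and
otherwise from the first demand. -/
def branchVertex (ds : List (Bool × List α)) : Option α :=
  ((ds.find? fun d => d.2.length == 1).or ds.head?).bind fun d => d.2.head?

theorem card_meets_nil [Finite α] :
    Nat.card {x : α → Bool // Meets x []} = 2 ^ Nat.card α := by
  simp [Meets, Nat.card_fun]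

theorem card_meets_eq_zero {ds : List (Bool × List α)} (h : ds.any (fun d => d.2.isEmpty) = true) :
    Nat.card {x // Meets x ds} = 0 := by
  obtain ⟨d, hd, hnil⟩ := List.any_eq_true.1 h
  have : IsEmpty {x // Meets x ds} :=
    ⟨fun x => by simpa [List.isEmpty_iff.1 hnil] using x.2 d hd⟩
  exact Nat.card_of_isEmpty

variable [DecidableEq α]

/-- The residual demands on the other vertices once `v` has colour `b`. -/
def assign (v : α) (b : Bool) (ds : List (Bool × List α)) : List (Bool × List α) :=
  ds.filterMap fun d =>
    if d.1 == b && d.2.elem v then none else some (d.1, d.2.filter fun w => !decide (w = v))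

/-- The number of 2-colourings of `n` vertices meeting all demands, computed by branching; `none`
if the branching does not decide all demands within depth `n`. -/
def countColourings : ℕ → List (Bool × List α) → Option ℕ
  | 0, ds => if ds.isEmpty then some 1 else if ds.any fun d => d.2.isEmpty then some 0 else none
  | n + 1, ds =>
    if ds.isEmpty then some (2 ^ (n + 1)) else if ds.any fun d => d.2.isEmpty then some 0 else
      (branchVertex ds).bind fun v =>
        Option.map₂ (· + ·) (countColourings n (assign v true ds))
          (countColourings n (assign v false ds))

theorem meets_assign_update_iff (x : α → Bool) (v : α) (b : Bool) (ds : List (Bool × List α)) :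
    Meets (Function.update x v b) (assign v (x v) ds) ↔ Meets x ds := by
  simp only [Meets, assign, List.mem_filterMap, forall_exists_index, and_imp]
  rw [forall_comm]
  refine forall_congr' fun d => ?_
  rw [forall_comm]
  refine forall_congr' fun _ => ?_
  simp only [Bool.and_eq_true, beq_iff_eq, List.elem_eq_mem, decide_eq_true_eq]
  split_ifs with h
  · simpa using ⟨v, h.2, h.1.symm⟩
  · simp only [Option.some.injEq, forall_eq', List.mem_filter, Bool.not_eq_true',
      decide_eq_false_iff_not]
    refine exists_congr fun w => ?_
    by_cases hw : w = v
    · subst hw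
      simp only [not_true_eq_false, and_false, false_and, false_iff]
      exact fun hx => h ⟨hx.2.symm, hx.1⟩
    · simp [hw]

theorem two_mul_card_meets (v : α) (ds : List (Bool × List α)) [Finite α] :
    2 * Nat.card {x // Meets x ds} =
      Nat.card {x // Meets x (assign v true ds)} + Nat.card {x // Meets x (assign v false ds)} := by
  let σ : Bool × (α → Bool) → Bool × (α → Bool) := fun p => (p.2 v, Function.update p.2 v p.1)
  have hσ : Function.Involutive σ := fun p => by simp [σ]
  have key := Nat.card_congr <| hσ.toPerm.subtypeEquiv
    (p := fun p => Meets p.2 ds) (q := fun p => Meets p.2 (assign v p.1 ds))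
    fun p => (meets_assign_update_iff p.2 v p.1 ds).symm
  rw [Nat.card_congr (Equiv.subtypeProdEquivSigmaSubtype fun _ x => Meets x ds),
    Nat.card_congr (Equiv.subtypeProdEquivSigmaSubtype fun b x => Meets x (assign v b ds)),
    Nat.card_sigma, Nat.card_sigma, Fintype.sum_bool, Fintype.sum_bool] at key
  rw [two_mul, key]

theorem card_meets_mul_two_pow [Finite α] {n r : ℕ} {ds : List (Bool × List α)}
    (h : countColourings n ds = some r) :
    Nat.card {x // Meets x ds} * 2 ^ n = r * 2 ^ Nat.card α := by
  induction n generalizing ds r with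
  | zero =>
    rw [countColourings] at h
    split_ifs at h with h₁ h₂
    · obtain rfl := Option.some.inj h
      rw [List.isEmpty_iff.1 h₁, card_meets_nil, pow_zero, mul_comm]
    · obtain rfl := Option.some.inj h
      rw [card_meets_eq_zero h₂, zero_mul, zero_mul]
  | succ n ih =>
    rw [countColourings] at h
    split_ifs at h with h₁ h₂
    · obtain rfl := Option.some.inj h
      rw [List.isEmpty_iff.1 h₁, card_meets_nil, mul_comm]
    · obtain rfl := Option.some.inj h
      rw [card_meets_eq_zero h₂, zero_mul, zero_mul]
    · obtain ⟨v, -, hv⟩ := Option.bind_eq_some_iff.1 h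
      obtain ⟨r₁, r₂, h₁, h₂, rfl⟩ := Option.map₂_eq_some_iff.1 hv
      rw [pow_succ', ← mul_assoc, mul_comm _ 2, two_mul_card_meets v, add_mul, add_mul, ih h₁,
        ih h₂]

theorem card_meets [Finite α] {r : ℕ} {ds : List (Bool × List α)}
    (h : countColourings (Nat.card α) ds = some r) : Nat.card {x // Meets x ds} = r :=
  Nat.eq_of_mul_eq_mul_right (by positivity) (card_meets_mul_two_pow h)

end Hypergraph

namespace AffinePlane

/-- A 2-colouring of the affine plane over `F` under which no line is monochromatic. -/
def IsProper {F : Type*} [Field F] (c : F × F → Bool) : Prop :=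
  ∀ p d : F × F, d ≠ 0 →
    (∃ t : F, c (p + t • d) = true) ∧ (∃ t : F, c (p + t • d) = false)

theorem isProper_comp_ringEquiv {F K : Type*} [Field F] [Field K] (φ : F ≃+* K)
    {c : K × K → Bool} (hc : IsProper c) : IsProper fun v : F × F => c (φ v.1, φ v.2) := by
  intro p d hd
  have hd' : (φ d.1, φ d.2) ≠ 0 := by
    simpa [Prod.ext_iff] using hd
  obtain ⟨⟨t, ht⟩, ⟨s, hs⟩⟩ := hc (φ p.1, φ p.2) (φ d.1, φ d.2) hd'
  exact ⟨⟨φ.symm t, by simpa using ht⟩, ⟨φ.symm s, by simpa using hs⟩⟩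

theorem card_isProper_congr {F K : Type*} [Field F] [Field K] (φ : F ≃+* K) :
    Nat.card {c : F × F → Bool // IsProper c} = Nat.card {c : K × K → Bool // IsProper c} :=
  Nat.card_congr
    { toFun c := ⟨_, isProper_comp_ringEquiv φ.symm c.2⟩
      invFun c := ⟨_, isProper_comp_ringEquiv φ c.2⟩
      left_inv c := by simp
      right_inv c := by simp }

theorem isProper_iff_slope_intercept {F : Type*} [Field F] (c : F × F → Bool) :
    IsProper c ↔
      (∀ (k : F) (b : Bool), ∃ v : F × F, v.1 = k ∧ c v = b) ∧
      ∀ (m k : F) (b : Bool), ∃ v : F × F, v.2 = m * v.1 + k ∧ c v = b := by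
  constructor
  · intro hc
    have hc' (p d : F × F) (hd : d ≠ 0) (b : Bool) : ∃ t : F, c (p + t • d) = b := by
      cases b
      exacts [(hc p d hd).2, (hc p d hd).1]
    refine ⟨fun k b => ?_, fun m k b => ?_⟩
    · obtain ⟨t, ht⟩ := hc' (k, 0) (0, 1) (by simp) b
      exact ⟨_, by simp, ht⟩
    · obtain ⟨t, ht⟩ := hc' (0, k) (1, m) (by simp) b
      exact ⟨_, by simp; ring, ht⟩
  · rintro ⟨hvert, hslope⟩ p d hd
    suffices h : ∀ b, ∃ t : F, c (p + t • d) = b from ⟨h true, h false⟩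
    intro b
    by_cases hd₁ : d.1 = 0
    · have hd₂ : d.2 ≠ 0 := fun hd₂ => hd (Prod.ext hd₁ hd₂)
      obtain ⟨v, hv, rfl⟩ := hvert p.1 b
      refine ⟨(v.2 - p.2) / d.2, congrArg c (Prod.ext ?_ ?_)⟩
      · simp [hd₁, hv]
      · simp [hd₂]
    · obtain ⟨v, hv, rfl⟩ := hslope (d.2 / d.1) (p.2 - d.2 / d.1 * p.1) b
      refine ⟨(v.1 - p.1) / d.1, congrArg c (Prod.ext ?_ ?_)⟩
      · simp [hd₁]
      · simp only [Prod.snd_add, Prod.smul_snd, smul_eq_mul, hv]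
        field_simp
        ring

/-- A computable model of the field with four elements: `𝔽₂[ω]` with `ω² = 1 + ω`. -/
abbrev F₄ : Type := QuadraticAlgebra (ZMod 2) 1 1

instance : Fact (∀ r : ZMod 2, r ^ 2 ≠ 1 + 1 * r) := ⟨by decide⟩

instance : Fintype F₄ := Fintype.ofEquiv _ (QuadraticAlgebra.equivProd 1 1).symm

/-- An enumeration of `F₄`. -/
def enumF₄ : Fin 4 ≃ F₄ :=
  (finProdFinEquiv (m := 2) (n := 2)).symm.trans
    (QuadraticAlgebra.equivProd (1 : ZMod 2) 1).symm

/-- An enumeration of the points of the affine plane over `F₄`. -/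
def enumPlane : Fin 16 ≃ F₄ × F₄ :=
  (finProdFinEquiv (m := 4) (n := 4)).symm.trans (enumF₄.prodCongr enumF₄)

/-- The demand that some point of the plane satisfying `q` has colour `b`. -/
def demand (q : F₄ × F₄ → Prop) [DecidablePred q] (b : Bool) : Bool × List (Fin 16) :=
  (b, (List.finRange 16).filter fun i => q (enumPlane i))

theorem exists_mem_demand_iff (c : F₄ × F₄ → Bool) (q : F₄ × F₄ → Prop) [DecidablePred q]
    (b : Bool) : (∃ i ∈ (demand q b).2, (c ∘ enumPlane) i = (demand q b).1) ↔
      ∃ v, q v ∧ c v = b := by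
  simp [demand, enumPlane.surjective.exists]

/-- The demands describing the proper 2-colourings of the affine plane over `F₄`. -/
def lineDemands : List (Bool × List (Fin 16)) :=
  [true, false].flatMap fun b => (List.finRange 4).flatMap fun k =>
    demand (fun v => v.1 = enumF₄ k) b ::
      (List.finRange 4).map fun m => demand (fun v => v.2 = enumF₄ m * v.1 + enumF₄ k) b

theorem mem_lineDemands_iff (d : Bool × List (Fin 16)) :
    d ∈ lineDemands ↔ ∃ b k, d = demand (fun v => v.1 = enumF₄ k) b ∨
      ∃ m, d = demand (fun v => v.2 = enumF₄ m * v.1 + enumF₄ k) b := by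
  simp only [lineDemands, List.mem_flatMap, List.mem_cons (a := d), List.mem_map,
    List.mem_finRange, true_and, eq_comm (a := d)]
  refine exists_congr fun b => and_iff_right ?_
  cases b <;> simp

theorem isProper_iff_meets_lineDemands (c : F₄ × F₄ → Bool) :
    IsProper c ↔ Hypergraph.Meets (c ∘ enumPlane) lineDemands := by
  rw [isProper_iff_slope_intercept]
  constructor
  · rintro ⟨hvert, hslope⟩ d hd
    obtain ⟨b, k, rfl | ⟨m, rfl⟩⟩ := (mem_lineDemands_iff d).1 hd
    · exact (exists_mem_demand_iff c _ b).2 (hvert _ b)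
    · exact (exists_mem_demand_iff c _ b).2 (hslope _ _ b)
  · intro h
    refine ⟨enumF₄.surjective.forall.2 fun k b => ?_,
      enumF₄.surjective.forall.2 fun m => enumF₄.surjective.forall.2 fun k b => ?_⟩
    · exact (exists_mem_demand_iff c _ b).1 (h _ ((mem_lineDemands_iff _).2 ⟨b, k, .inl rfl⟩))
    · exact (exists_mem_demand_iff c _ b).1
        (h _ ((mem_lineDemands_iff _).2 ⟨b, k, .inr ⟨m, rfl⟩⟩))

theorem countColourings_lineDemands :
    Hypergraph.countColourings 16 lineDemands = some 120 := by
  decide +kernel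

theorem card_isProper_F₄ : Nat.card {c : F₄ × F₄ → Bool // IsProper c} = 120 := by
  rw [Nat.card_congr <| (enumPlane.symm.arrowCongr (Equiv.refl Bool)).subtypeEquiv
    (q := fun x => Hypergraph.Meets x lineDemands) isProper_iff_meets_lineDemands]
  exact Hypergraph.card_meets (by rw [Nat.card_fin]; exact countColourings_lineDemands)

theorem nonempty_ringEquiv_F₄ : Nonempty (GaloisField 2 2 ≃+* F₄) := by
  have := Fintype.ofFinite (GaloisField 2 2)
  refine ⟨FiniteField.ringEquivOfCardEq ?_⟩
  rw [← Nat.card_eq_fintype_card, GaloisField.card 2 2 two_ne_zero, Fintype.card_congr enumF₄.symm]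
  rfl

end AffinePlane

/-- The affine plane of order 4 (points `F × F` for `F = GaloisField 2 2`, lines the sets
`{p + t • d : t ∈ F}` with `d ≠ 0`) has exactly 120 proper 2-colourings, i.e. 120 functions
`c : F × F → Bool` making no line monochromatic. -/
theorem affine_plane_four_colourings :
    Nat.card {c : GaloisField 2 2 × GaloisField 2 2 → Bool //
        ∀ p d : GaloisField 2 2 × GaloisField 2 2, d ≠ 0 →
          (∃ t : GaloisField 2 2, c (p + t • d) = true) ∧
          (∃ t : GaloisField 2 2, c (p + t • d) = false)} = 120 := by
  obtain ⟨φ⟩ := AffinePlane.nonempty_ringEquiv_F₄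
  exact (AffinePlane.card_isProper_congr φ).trans AffinePlane.card_isProper_F₄
end

section
/- Let F be the field with four elements (GaloisField 2 2) and let V = F × F. Let the edges be all affine lines of the plane V, i.e., all sets of the form {p + t • d : t ∈ F} for p ∈ V and nonzero d ∈ V. Then every function c : V → Bool under which no line is monochromatic assigns the value true to exactly 8 of the 16 points (and hence the value false to exactly 8 points). -/
section LineSums

variable {F : Type*} [Field F] [Fintype F]

/-- The sum of `x` over an affine line of `F × F`: the vertical line with abscissa `b` when the
direction is `none`, and the line of slope `m` and intercept `b` when it is `some m`. -/
def lineSum (x : F × F → ℤ) : Option F → F → ℤ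
  | none, b => ∑ t, x (b, t)
  | some m, b => ∑ t, x (t, b + t * m)

/-- The intercept of the line through `v` with the given direction. -/
def lineThrough (v : F × F) : Option F → F
  | none => v.1
  | some m => v.2 - v.1 * m

lemma sum_lineSum (x : F × F → ℤ) (k : Option F) : ∑ b, lineSum x k b = ∑ v, x v := by
  rw [Fintype.sum_prod_type]
  cases k with
  | none => rfl
  | some m =>
    simp only [lineSum]
    rw [Finset.sum_comm]
    exact Finset.sum_congr rfl fun t _ =>
      Fintype.sum_equiv (Equiv.addRight (t * m)) _ _ fun b => rfl

lemma sum_lineSum_lineThrough (x : F × F → ℤ) (v : F × F) :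
    ∑ k, lineSum x k (lineThrough v k) = ∑ w, x w + Fintype.card F * x v := by
  classical
  obtain ⟨a, b⟩ := v
  rw [Fintype.sum_option, Fintype.sum_prod_type]
  simp only [lineSum, lineThrough]
  rw [Finset.sum_comm, ← Finset.add_sum_erase _ (fun s => ∑ m, x (s, b - a * m + s * m)) (Finset.mem_univ a),
    ← Finset.add_sum_erase _ (fun s => ∑ t, x (s, t)) (Finset.mem_univ a)]
  have h : ∀ s ∈ Finset.univ.erase a, ∑ m, x (s, b - a * m + s * m) = ∑ t, x (s, t) := by
    intro s hs
    have hsa : s - a ≠ 0 := sub_ne_zero.2 (Finset.ne_of_mem_erase hs)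
    refine Fintype.sum_equiv ((Equiv.mulLeft₀ (s - a) hsa).trans (Equiv.addLeft b)) _ _ fun m => ?_
    congr 2
    simp only [Equiv.trans_apply, Equiv.mulLeft₀_apply, Equiv.coe_addLeft]
    ring
  rw [Finset.sum_congr rfl h]
  simp
  ring

lemma sum_mul_lineThrough (x : F × F → ℤ) (g : F → ℤ) (k : Option F) :
    ∑ v, x v * g (lineThrough v k) = ∑ b, lineSum x k b * g b := by
  rw [Fintype.sum_prod_type]
  cases k with
  | none => simp only [lineSum, lineThrough, Finset.sum_mul]
  | some m =>
    simp only [lineSum, lineThrough, Finset.sum_mul]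
    rw [Finset.sum_comm (s := Finset.univ) (t := Finset.univ) (f := fun b t => x (t, b + t * m) * g b)]
    refine Finset.sum_congr rfl fun t _ =>
      (Fintype.sum_equiv (Equiv.addRight (t * m)) _ _ fun b => ?_).symm
    simp

lemma sum_sq_lineSum (x : F × F → ℤ) :
    ∑ k, ∑ b, lineSum x k b ^ 2 = (∑ v, x v) ^ 2 + Fintype.card F * ∑ v, x v ^ 2 := by
  have h (k : Option F) :
      ∑ b, lineSum x k b ^ 2 = ∑ v, x v * lineSum x k (lineThrough v k) := by
    rw [sum_mul_lineThrough]
    simp only [sq]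
  simp only [h]
  rw [Finset.sum_comm]
  simp only [← Finset.mul_sum, sum_lineSum_lineThrough]
  simp only [mul_add, Finset.sum_add_distrib, ← Finset.sum_mul]
  rw [sq]
  congr 1
  rw [Finset.mul_sum]
  exact Finset.sum_congr rfl fun v _ => by ring

end LineSums

lemma odd_sum_of_card_odd {ι : Type*} [Fintype ι] (f : ι → ℤ) (hι : Odd (Fintype.card ι))
    (hf : ∀ i, Odd (f i)) : Odd (∑ i, f i) := by
  have h : Even (∑ i, (f i - 1)) := Finset.even_sum _ fun i _ => (hf i).sub_odd odd_one
  rw [Finset.sum_sub_distrib] at h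
  have hcard : Odd (∑ _i : ι, (1 : ℤ)) := by simpa using hι
  simpa using h.add_odd hcard

lemma even_sum_sq_sub_sum {ι : Type*} [Fintype ι] (f : ι → ℤ) :
    Even (∑ i, f i ^ 2 - ∑ i, f i) := by
  rw [← Finset.sum_sub_distrib]
  refine Finset.even_sum _ fun i _ => ?_
  have := Int.even_mul_pred_self (f i)
  rwa [show f i ^ 2 - f i = f i * (f i - 1) by ring]

/-- The sign attached to a colour. -/
def colourSign (b : Bool) : ℤ := if b then 1 else -1

lemma exists_sum_colourSign {ι : Type*} [Fintype ι] (hι : Fintype.card ι = 4) (g : ι → Bool)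
    (ht : ∃ i, g i = true) (hf : ∃ i, g i = false) :
    ∃ u : ℤ, u ^ 2 ≤ 1 ∧ ∑ i, colourSign (g i) = 2 * u := by
  have key : ∀ h : Fin 4 → Bool, (∃ i, h i = true) → (∃ i, h i = false) →
      ∑ i, colourSign (h i) = 2 * -1 ∨ ∑ i, colourSign (h i) = 2 * 0 ∨
        ∑ i, colourSign (h i) = 2 * 1 := by
    decide
  let e := Fintype.equivFinOfCardEq hι
  rw [← Equiv.sum_comp e.symm]
  have ht' : ∃ i, g (e.symm i) = true := e.symm.surjective.exists.1 ht
  have hf' : ∃ i, g (e.symm i) = false := e.symm.surjective.exists.1 hf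
  rcases key (fun i => g (e.symm i)) ht' hf' with h | h | h <;>
    exact ⟨_, by norm_num, h⟩

/-- Halved line sums `u` in the plane of order 4 have total `m` in each parallel class, and
their squares add up to `16 + m ^ 2`; with all `|u| ≤ 1` this forces `m = 0`. -/
lemma sum_colourSign_eq_zero {F : Type*} [Field F] [Fintype F] (hF : Fintype.card F = 4)
    (c : F × F → Bool)
    (hc : ∀ p d : F × F, d ≠ 0 →
      (∃ t : F, c (p + t • d) = true) ∧ (∃ t : F, c (p + t • d) = false)) :
    ∑ v, colourSign (c v) = 0 := by
  set x : F × F → ℤ := fun v => colourSign (c v) with hx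
  have hline : ∀ k b, ∃ u : ℤ, u ^ 2 ≤ 1 ∧ lineSum x k b = 2 * u := by
    rintro (_ | m) b
    · obtain ⟨ht, hf⟩ := hc (b, 0) (0, 1) (by simp)
      simpa [lineSum] using exists_sum_colourSign hF _ ht hf
    · obtain ⟨ht, hf⟩ := hc (0, b) (1, m) (by simp)
      simpa [lineSum] using exists_sum_colourSign hF _ ht hf
  choose u hu hL using hline
  set m := ∑ b, u none b
  have hT : ∑ v, x v = 2 * m := by
    rw [← sum_lineSum x none]
    simp only [hL, ← Finset.mul_sum, m]
  have hclass (k : Option F) : ∑ b, u k b = m := by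
    have h := sum_lineSum x k
    simp only [hL, ← Finset.mul_sum, hT] at h
    linarith
  have hsq : ∑ k, ∑ b, u k b ^ 2 = 16 + m ^ 2 := by
    have h := sum_sq_lineSum x
    have hx2 : ∀ v, x v ^ 2 = 1 := fun v => by cases h : c v <;> simp [hx, colourSign, h]
    simp only [hL, hT, hx2, mul_pow, ← Finset.mul_sum] at h
    simp [-Fintype.sum_option, hF] at h
    linarith
  have hle (k : Option F) : ∑ b, u k b ^ 2 ≤ 4 := by
    simpa [hF] using Finset.sum_le_sum fun b (_ : b ∈ Finset.univ) => hu k b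
  have hO : Fintype.card (Option F) = 5 := by simp [hF]
  rcases Int.even_or_odd m with hm | hm
  · by_contra hne
    have hm0 : m ≠ 0 := fun h => hne (by rw [hT, h, mul_zero])
    have hm4 : 4 ≤ m ^ 2 := by
      obtain ⟨r, hr⟩ := hm
      have : 0 < r ^ 2 := by
        have : r ≠ 0 := by rintro rfl; exact hm0 hr
        positivity
      rw [hr]
      nlinarith
    have hall (k : Option F) (b : F) : u k b ^ 2 = 1 := by
      by_contra h
      have hlt : ∑ k, ∑ b, u k b ^ 2 < ∑ _k : Option F, ∑ _b : F, (1 : ℤ) :=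
        Finset.sum_lt_sum (fun k _ => Finset.sum_le_sum fun b _ => hu k b)
          ⟨k, Finset.mem_univ k, Finset.sum_lt_sum (fun b _ => hu k b)
            ⟨b, Finset.mem_univ b, lt_of_le_of_ne (hu k b) h⟩⟩
      simp [-Fintype.sum_option, hF] at hlt
      linarith
    have hodd : Odd (∑ k, u k (lineThrough 0 k)) := by
      refine odd_sum_of_card_odd _ (by rw [hO]; decide) fun k => ?_
      have h : Odd (u k (lineThrough 0 k) ^ 2) := by rw [hall]; exact odd_one
      exact (Int.odd_pow' two_ne_zero).1 h
    have hpt := sum_lineSum_lineThrough x 0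
    simp only [hL, hT, ← Finset.mul_sum, hF] at hpt
    push_cast at hpt
    rcases hm with ⟨r, hr⟩
    rcases hodd with ⟨s, hs⟩
    omega
  · have hle3 (k : Option F) : ∑ b, u k b ^ 2 ≤ 3 := by
      have h1 := even_sum_sq_sub_sum (u k)
      rw [hclass] at h1
      have h2 := hle k
      rcases hm with ⟨r, hr⟩
      rcases h1 with ⟨s, hs⟩
      omega
    have h := Finset.sum_le_sum fun k (_ : k ∈ Finset.univ) => hle3 k
    rw [hsq] at h
    simp [hF] at h
    nlinarith [sq_nonneg m]

/-- Every proper 2-colouring of the affine plane of order 4 (points `F × F` for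
`F = GaloisField 2 2`, lines the sets `{p + t • d : t ∈ F}` with `d ≠ 0`) colours exactly
8 of the 16 points `true` (and hence exactly 8 points `false`). -/
theorem affine_plane_four_colourings_balanced
    (c : GaloisField 2 2 × GaloisField 2 2 → Bool)
    (hc : ∀ p d : GaloisField 2 2 × GaloisField 2 2, d ≠ 0 →
      (∃ t : GaloisField 2 2, c (p + t • d) = true) ∧
      (∃ t : GaloisField 2 2, c (p + t • d) = false)) :
    Nat.card {v : GaloisField 2 2 × GaloisField 2 2 // c v = true} = 8 ∧
    Nat.card {v : GaloisField 2 2 × GaloisField 2 2 // c v = false} = 8 := by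
  classical
  let _ : Fintype (GaloisField 2 2) := Fintype.ofFinite _
  have hF : Fintype.card (GaloisField 2 2) = 4 := by
    rw [← Nat.card_eq_fintype_card, GaloisField.card 2 2 two_ne_zero]
    norm_num
  have hsum := sum_colourSign_eq_zero hF c hc
  have htot := Finset.card_filter_add_card_filter_not (s := Finset.univ) (fun v => c v = true)
  simp only [colourSign, Finset.sum_ite, Finset.sum_const] at hsum
  simp only [Finset.card_univ, Fintype.card_prod, hF, Bool.not_eq_true] at htot hsum
  simp only [Nat.card_eq_fintype_card, Fintype.card_subtype]
  simp only [nsmul_eq_mul] at hsum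
  omega
end

section
/- The 4-uniform hypergraph on the vertex set {1, 2, ..., 11} whose 23 edges are {1,2,9,10}, {3,4,9,10}, {5,6,9,10}, {7,8,9,10}, {1,2,9,11}, {3,4,9,11}, {5,6,9,11}, {7,8,9,11}, {1,2,10,11}, {3,4,10,11}, {5,6,10,11}, {7,8,10,11}, {1,3,5,8}, {1,3,6,7}, {1,4,5,7}, {1,4,6,7}, {1,4,6,8}, {2,3,5,7}, {2,3,6,7}, {2,3,6,8}, {2,4,5,7}, {2,4,5,8}, {2,4,6,8} admits no proper 2-colouring. (This is the Seymour–Toft example witnessing m(4) ≤ 23.) -/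
/-- The elements of `{p, q, r, s}` do not all have the same colour iff one of `q`, `r`, `s` has
a colour different from that of `p`. -/
theorem exists_ne_colour_quadruple_iff {V C : Type*} [DecidableEq V] (f : V → C) (p q r s : V) :
    (∃ v ∈ ({p, q, r, s} : Finset V), ∃ w ∈ ({p, q, r, s} : Finset V), f v ≠ f w) ↔
      ¬(f p = f q ∧ f p = f r ∧ f p = f s) := by
  simp only [Finset.mem_insert, Finset.mem_singleton, exists_eq_or_imp, exists_eq_left]
  grind

set_option synthInstance.maxHeartbeats 200000 in
set_option synthInstance.maxSize 1024 in
set_option maxRecDepth 10000 in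
/-- The Seymour–Toft 4-uniform hypergraph on `{1, …, 11}` with 23 edges admits no proper
2-colouring (witnessing `m(4) ≤ 23`). -/
theorem seymour_toft_not_two_colourable :
    ∀ c : ℕ → Bool,
      ∃ e ∈ ({ {1,2,9,10}, {3,4,9,10}, {5,6,9,10}, {7,8,9,10},
               {1,2,9,11}, {3,4,9,11}, {5,6,9,11}, {7,8,9,11},
               {1,2,10,11}, {3,4,10,11}, {5,6,10,11}, {7,8,10,11},
               {1,3,5,8}, {1,3,6,7}, {1,4,5,7}, {1,4,6,7}, {1,4,6,8},
               {2,3,5,7}, {2,3,6,7}, {2,3,6,8}, {2,4,5,7}, {2,4,5,8},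
               {2,4,6,8} } : Finset (Finset ℕ)),
        ∀ v ∈ e, ∀ w ∈ e, c v = c w := by
  intro c
  by_contra! h
  simp only [Finset.mem_insert (α := Finset ℕ), Finset.mem_singleton (α := Finset ℕ),
    forall_eq_or_imp, forall_eq, exists_ne_colour_quadruple_iff] at h
  generalize c 1 = x₁, c 2 = x₂, c 3 = x₃, c 4 = x₄, c 5 = x₅, c 6 = x₆, c 7 = x₇, c 8 = x₈,
    c 9 = x₉, c 10 = x₁₀, c 11 = x₁₁ at h
  cases x₉ <;> cases x₁₀ <;> cases x₁₁ <;> revert x₁ x₂ x₃ x₄ x₅ x₆ x₇ x₈ <;> decide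
end
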